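/- Let μ be a compactly supported finite Borel measure on ℝ^d with |μ̂(ξ)| ≤ C|ξ|^{−a} for all ξ ≠ 0, where a > 1/2. Then for every p with 1 < p ≤ 2 there is a constant C' such that for every integer j ≥ 1 and every Schwartz function f, ‖T_j^* f‖_{L^p(ℝ^d)} ≤ C' 2^{(2a+1)(1/p − 2a/(2a+1)) j} ‖f‖_{L^p(ℝ^d)}. -/

import Mathlib

open MeasureTheory Real Set Metric FourierTransform
open scoped ENNReal NNReal RealInnerProductSpace

noncomputable section

variable {d : ℕ}

/-- Fourier transform of a finite Borel measure on ℝ^d:  μ̂(ξ) = ∫ e^{−2πi x·ξ} dμ(x). -/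
def mFT (μ : Measure (EuclideanSpace ℝ (Fin d))) (ξ : EuclideanSpace ℝ (Fin d)) : ℂ :=
  ∫ x, Complex.exp (-(2 * (π : ℂ) * Complex.I * ((⟪x, ξ⟫ : ℝ) : ℂ))) ∂μ

/-- Convolution with the dilated measure: (f ∗ μ_t)(x) = ∫ f(x − t y) dμ(y). -/
def convM (f : EuclideanSpace ℝ (Fin d) → ℂ) (μ : Measure (EuclideanSpace ℝ (Fin d)))
    (t : ℝ) (x : EuclideanSpace ℝ (Fin d)) : ℂ :=
  ∫ y, f (x - t • y) ∂μ

/-- Global maximal function M_μ f(x) = sup_{t>0} |(f ∗ μ_t)(x)|. -/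
def Mmax (μ : Measure (EuclideanSpace ℝ (Fin d))) (f : EuclideanSpace ℝ (Fin d) → ℂ)
    (x : EuclideanSpace ℝ (Fin d)) : ℝ≥0∞ :=
  ⨆ t : {t : ℝ // 0 < t}, (‖convM f μ t x‖₊ : ℝ≥0∞)

/-- Local maximal function M_μ^{loc} f(x) = sup_{t∈[1,2]} |(f ∗ μ_t)(x)|. -/
def MmaxLoc (μ : Measure (EuclideanSpace ℝ (Fin d))) (f : EuclideanSpace ℝ (Fin d) → ℂ)
    (x : EuclideanSpace ℝ (Fin d)) : ℝ≥0∞ :=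
  ⨆ t : (Icc (1:ℝ) 2), (‖convM f μ t x‖₊ : ℝ≥0∞)

/-- L^p norm (in lintegral form) of an ℝ≥0∞-valued function on ℝ^d. -/
def lpE (g : EuclideanSpace ℝ (Fin d) → ℝ≥0∞) (p : ℝ) : ℝ≥0∞ :=
  (∫⁻ x, g x ^ p) ^ (1 / p)

/-- Weak L^q quasinorm of an ℝ≥0∞-valued function on ℝ^d. -/
def wlpE (g : EuclideanSpace ℝ (Fin d) → ℝ≥0∞) (q : ℝ) : ℝ≥0∞ :=
  ⨆ l : ℝ≥0, (l : ℝ≥0∞) * (volume {x | (l : ℝ≥0∞) < g x}) ^ (1 / q)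

/-- Lorentz L^{p,1} norm (up to a constant factor p) of a complex-valued function. -/
def lorentz1 (f : EuclideanSpace ℝ (Fin d) → ℂ) (p : ℝ) : ℝ≥0∞ :=
  ∫⁻ l in Ioi (0:ℝ), (volume {x | l < ‖f x‖}) ^ (1 / p)

/-- Lorentz L^{p,r} quasinorm of a real-valued function,
‖f‖_{p,r} = ( ∫_0^∞ (λ · d_f(λ)^{1/p})^r dλ/λ )^{1/r}. -/
def lorentzR (f : EuclideanSpace ℝ (Fin d) → ℝ) (p r : ℝ) : ℝ≥0∞ :=
  (∫⁻ l in Ioi (0:ℝ),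
      (ENNReal.ofReal l * (volume {x | l < |f x|}) ^ (1 / p)) ^ r / ENNReal.ofReal l) ^ (1 / r)

/-- Littlewood–Paley projection P_k for k ∈ ℤ: (P_k f)^(ξ) = β(2^{−k}|ξ|) f̂(ξ). -/
def Pproj (β : ℝ → ℝ) (k : ℤ) (f : EuclideanSpace ℝ (Fin d) → ℂ)
    (x : EuclideanSpace ℝ (Fin d)) : ℂ :=
  ∫ ξ, Complex.exp (2 * (π : ℂ) * Complex.I * ((⟪x, ξ⟫ : ℝ) : ℂ)) *
    ((β ((2:ℝ) ^ (-k) * ‖ξ‖) : ℝ) : ℂ) * 𝓕 f ξ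

/-- The multiplier operator T_j^t, with multiplier m_j(tξ) = μ̂(tξ) β(2^{−j}|tξ|). -/
def Tj (μ : Measure (EuclideanSpace ℝ (Fin d))) (β : ℝ → ℝ) (j : ℕ) (t : ℝ)
    (f : EuclideanSpace ℝ (Fin d) → ℂ) (x : EuclideanSpace ℝ (Fin d)) : ℂ :=
  ∫ ξ, Complex.exp (2 * (π : ℂ) * Complex.I * ((⟪x, ξ⟫ : ℝ) : ℂ)) *
    (((β ((2:ℝ) ^ (-(j:ℤ)) * ‖t • ξ‖) : ℝ) : ℂ) * mFT μ (t • ξ)) * 𝓕 f ξ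

/-- The maximal multiplier operator T_j^* f(x) = sup_{t>0} |T_j^t f(x)|. -/
def TjStar (μ : Measure (EuclideanSpace ℝ (Fin d))) (β : ℝ → ℝ) (j : ℕ)
    (f : EuclideanSpace ℝ (Fin d) → ℂ) (x : EuclideanSpace ℝ (Fin d)) : ℝ≥0∞ :=
  ⨆ t : {t : ℝ // 0 < t}, (‖Tj μ β j t f x‖₊ : ℝ≥0∞)

/-- M_j f(x) = sup_{k∈ℤ} sup_{2^{−k} ≤ t < 2^{−k+1}} |(P_{k+j} f ∗ μ_t)(x)|. -/
def Mj (μ : Measure (EuclideanSpace ℝ (Fin d))) (β : ℝ → ℝ) (j : ℕ)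
    (f : EuclideanSpace ℝ (Fin d) → ℂ) (x : EuclideanSpace ℝ (Fin d)) : ℝ≥0∞ :=
  ⨆ k : ℤ, ⨆ t : (Ico ((2:ℝ) ^ (-k)) ((2:ℝ) ^ (-k+1))),
    (‖convM (Pproj β (k + j) f) μ t x‖₊ : ℝ≥0∞)

/-- P_j(μ_t ∗ μ̄_s)(x) = ∫ e^{2πi x·ξ} β(2^{−j}|ξ|) μ̂(tξ) conj(μ̂(sξ)) dξ. -/
def Kdisp (μ : Measure (EuclideanSpace ℝ (Fin d))) (β : ℝ → ℝ) (j : ℕ) (t s : ℝ)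
    (x : EuclideanSpace ℝ (Fin d)) : ℂ :=
  ∫ ξ, Complex.exp (2 * (π : ℂ) * Complex.I * ((⟪x, ξ⟫ : ℝ) : ℂ)) *
    ((β ((2:ℝ) ^ (-(j:ℤ)) * ‖ξ‖) : ℝ) : ℂ) * (mFT μ (t • ξ) * (starRingEnd ℂ) (mFT μ (s • ξ)))

/-- Convolution of a nonnegative function with a dilated measure, valued in [0,∞]. -/
def convNN (g : EuclideanSpace ℝ (Fin d) → ℝ) (σ : Measure (EuclideanSpace ℝ (Fin d)))
    (t : ℝ) (x : EuclideanSpace ℝ (Fin d)) : ℝ≥0∞ :=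
  ∫⁻ y, ENNReal.ofReal (g (x - t • y)) ∂σ

/-! ### Plancherel for `L¹ ∩ L²` -/

section Plancherel

variable {V : Type*} [NormedAddCommGroup V] [InnerProductSpace ℝ V] [FiniteDimensional ℝ V]
  [MeasurableSpace V] [BorelSpace V]

lemma fourier_ae_eq_L2 {f : V → ℂ} (hf : Integrable f) (hf2 : MemLp f 2) :
    (𝓕 (hf2.toLp f) : Lp (α := V) ℂ 2) =ᵐ[volume] 𝓕 f := by
  have hcont : Continuous (𝓕 f) := by
    apply VectorFourier.fourierIntegral_continuous Real.continuous_fourierChar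
      (by simpa using continuous_inner) hf
  apply ae_eq_of_integral_contDiff_smul_eq
  · exact (Lp.memLp _).locallyIntegrable (by norm_num)
  · exact hcont.locallyIntegrable
  intro g hg hgc
  have hgc' : HasCompactSupport (fun x => (g x : ℂ)) := hgc.comp_left (g := fun r : ℝ => (r : ℂ)) rfl
  have hg' : ContDiff ℝ (⊤ : ℕ∞) (fun x => (g x : ℂ)) := Complex.ofRealCLM.contDiff.comp hg
  let φ : SchwartzMap V ℂ := hgc'.toSchwartzMap hg'
  have hφ : ∀ x, φ x = (g x : ℂ) := fun x => rfl
  have h1 := congrArg (fun T => T φ) (Lp.fourier_toTemperedDistribution_eq (hf2.toLp f))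
  simp only [TemperedDistribution.fourier_apply, Lp.toTemperedDistribution_apply] at h1
  have h2 : ∫ x, g x • (𝓕 (hf2.toLp f) : Lp (α := V) ℂ 2 volume) x
      = ∫ x, φ x • (𝓕 (hf2.toLp f) : Lp (α := V) ℂ 2 volume) x := by
    simp [hφ]
  rw [h2, ← h1]
  have h3 : ∫ x, (𝓕 φ) x • (hf2.toLp f) x = ∫ x, (𝓕 (φ : V → ℂ)) x • f x := by
    apply integral_congr_ae
    filter_upwards [hf2.coeFn_toLp] with x hx
    rw [hx, SchwartzMap.fourier_coe]
  rw [h3]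
  have h4 := VectorFourier.integral_fourierIntegral_smul_eq_flip (L := innerₗ V) (μ := volume)
    (ν := volume) (f := (φ : V → ℂ)) (g := f) Real.continuous_fourierChar
      (by simpa using continuous_inner) φ.integrable hf
  have h5 : (innerₗ V).flip = innerₗ V := by
    ext x y
    simp
  rw [h5] at h4
  refine h4.trans ?_
  simp only [hφ]
  apply integral_congr_ae
  filter_upwards with x
  simp [Real.fourier_eq]
  left
  rfl

lemma lintegral_fourier_sq {f : V → ℂ} (hf : Integrable f) (hf2 : MemLp f 2) :
    ∫⁻ x, ‖𝓕 f x‖ₑ ^ 2 = ∫⁻ x, ‖f x‖ₑ ^ 2 := by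
  have key : ∀ g : Lp (α := V) ℂ 2, ∫⁻ x, ‖g x‖ₑ ^ 2 = ‖g‖ₑ ^ 2 := by
    intro g
    rw [Lp.enorm_def, eLpNorm_eq_lintegral_rpow_enorm_toReal (by norm_num) (by norm_num)]
    simp only [ENNReal.toReal_ofNat, ENNReal.rpow_ofNat]
    rw [← ENNReal.rpow_natCast, ← ENNReal.rpow_mul]
    norm_num
  have h1 : ∫⁻ x, ‖𝓕 f x‖ₑ ^ 2 = ∫⁻ x, ‖(𝓕 (hf2.toLp f) : Lp (α := V) ℂ 2 volume) x‖ₑ ^ 2 := by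
    apply lintegral_congr_ae
    filter_upwards [fourier_ae_eq_L2 hf hf2] with x hx
    rw [hx]
  have h2 : ∫⁻ x, ‖f x‖ₑ ^ 2 = ∫⁻ x, ‖(hf2.toLp f) x‖ₑ ^ 2 := by
    apply lintegral_congr_ae
    filter_upwards [hf2.coeFn_toLp] with x hx
    rw [hx]
  rw [h1, h2, key, key, ← ofReal_norm, ← ofReal_norm, Lp.norm_fourier_eq]

lemma lintegral_fourierInv_sq {f : V → ℂ} (hf : Integrable f) (hf2 : MemLp f 2) :
    ∫⁻ x, ‖𝓕⁻ f x‖ₑ ^ 2 = ∫⁻ x, ‖f x‖ₑ ^ 2 := by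
  rw [← lintegral_fourier_sq hf hf2]
  simp_rw [Real.fourierInv_eq_fourier_neg]
  exact (Measure.measurePreserving_neg (volume : Measure V)).lintegral_comp_emb
    (Homeomorph.neg V).measurableEmbedding (fun x => ‖𝓕 f x‖ₑ ^ 2)

end Plancherel



/-! ### Basic facts on `mFT` and `Tj` -/

abbrev Ed (d : ℕ) := EuclideanSpace ℝ (Fin d)

lemma norm_exp_I (r : ℝ) : ‖Complex.exp (2 * (π : ℂ) * Complex.I * (r : ℂ))‖ = 1 := by
  have : 2 * (π : ℂ) * Complex.I * (r : ℂ) = ((2 * π * r : ℝ) : ℂ) * Complex.I := by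
    push_cast; ring
  rw [this, Complex.norm_exp_ofReal_mul_I]

lemma norm_exp_neg_I (r : ℝ) : ‖Complex.exp (-(2 * (π : ℂ) * Complex.I * (r : ℂ)))‖ = 1 := by
  have := norm_exp_I (-r)
  push_cast at this
  rw [← this]; ring_nf

lemma mFT_norm_le (μ : Measure (Ed d)) [IsFiniteMeasure μ] (ξ : Ed d) :
    ‖mFT μ ξ‖ ≤ μ.real univ := by
  unfold mFT
  refine (norm_integral_le_integral_norm _).trans ?_
  simp [norm_exp_neg_I]

lemma mFT_continuous (μ : Measure (Ed d)) [IsFiniteMeasure μ] : Continuous (mFT μ) := by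
  unfold mFT
  refine continuous_of_dominated (bound := fun _ => 1) ?_ ?_ (integrable_const _) ?_
  · intro ξ
    refine Continuous.aestronglyMeasurable ?_
    fun_prop
  · intro ξ
    filter_upwards with x
    rw [norm_exp_neg_I]
  · filter_upwards with x
    fun_prop

/-- multiplier -/
def mj (μ : Measure (Ed d)) (β : ℝ → ℝ) (j : ℕ) (ξ : Ed d) : ℂ :=
  ((β ((2:ℝ) ^ (-(j:ℤ)) * ‖ξ‖) : ℝ) : ℂ) * mFT μ ξ

lemma mj_continuous (μ : Measure (Ed d)) [IsFiniteMeasure μ] {β : ℝ → ℝ} (hβ : Continuous β)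
    (j : ℕ) : Continuous (mj μ β j) := by
  unfold mj
  have := mFT_continuous μ
  fun_prop

lemma beta_zero {β : ℝ → ℝ} (hβsupp : Function.support β ⊆ Ioo (1/2 : ℝ) 2) {r : ℝ}
    (hr : r ∉ Ioo (1/2 : ℝ) 2) : β r = 0 := by
  by_contra h
  exact hr (hβsupp h)

lemma beta_radial_support {β : ℝ → ℝ} (hβsupp : Function.support β ⊆ Ioo (1/2 : ℝ) 2)
    {c : ℝ} (hc : 0 < c) {ξ : Ed d} (h : β (c * ‖ξ‖) ≠ 0) : ξ ∈ closedBall (0 : Ed d) (2 / c) := by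
  have := (hβsupp h).2
  rw [mem_closedBall_zero_iff, le_div_iff₀ hc]
  linarith

lemma beta_radial_compact {β : ℝ → ℝ} (hβsupp : Function.support β ⊆ Ioo (1/2 : ℝ) 2)
    {c : ℝ} (hc : 0 < c) : HasCompactSupport (fun ξ : Ed d => ((β (c * ‖ξ‖) : ℝ) : ℂ)) := by
  refine HasCompactSupport.intro (isCompact_closedBall (0 : Ed d) (2 / c)) ?_
  intro ξ hξ
  by_contra h
  exact hξ (beta_radial_support hβsupp hc (by simpa using h))

lemma mj_smul_compact (μ : Measure (Ed d)) {β : ℝ → ℝ}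
    (hβsupp : Function.support β ⊆ Ioo (1/2 : ℝ) 2)
    (j : ℕ) {t : ℝ} (ht : 0 < t) : HasCompactSupport (fun ξ => mj μ β j (t • ξ)) := by
  have h := (beta_radial_compact (d := d) hβsupp
    (c := (2:ℝ) ^ (-(j:ℤ)) * t) (by positivity)).mul_right (f' := fun ξ => mFT μ (t • ξ))
  have e : (fun ξ => mj μ β j (t • ξ)) = (fun ξ : Ed d =>
      ((β ((2:ℝ) ^ (-(j:ℤ)) * t * ‖ξ‖) : ℝ) : ℂ)) * fun ξ => mFT μ (t • ξ) := by
    ext ξ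
    simp [mj, norm_smul, abs_of_pos ht, mul_assoc]
  rw [e]
  exact h

lemma fourier_cont {h : Ed d → ℂ} (hh : Integrable h) : Continuous (𝓕 h) :=
  VectorFourier.fourierIntegral_continuous Real.continuous_fourierChar
      (by simpa using continuous_inner) hh

lemma fourier_norm_le (h : Ed d → ℂ) (ξ : Ed d) : ‖𝓕 h ξ‖ ≤ ∫ x, ‖h x‖ :=
  VectorFourier.norm_fourierIntegral_le_integral_norm _ _ _ _ _

lemma mjF_cont (μ : Measure (Ed d)) [IsFiniteMeasure μ] {β : ℝ → ℝ} (hβ : Continuous β)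
    (j : ℕ) {h : Ed d → ℂ} (hh : Integrable h) (t : ℝ) :
    Continuous (fun ξ => mj μ β j (t • ξ) * 𝓕 h ξ) := by
  have := mj_continuous μ hβ j
  have := fourier_cont hh
  fun_prop

lemma mjF_supp (μ : Measure (Ed d)) {β : ℝ → ℝ}
    (hβsupp : Function.support β ⊆ Ioo (1/2 : ℝ) 2)
    (j : ℕ) (h : Ed d → ℂ) {t : ℝ} (ht : 0 < t) :
    HasCompactSupport (fun ξ => mj μ β j (t • ξ) * 𝓕 h ξ) :=
  (mj_smul_compact μ hβsupp j ht).mul_right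

lemma Tj_eq_fourierInv (μ : Measure (Ed d)) (β : ℝ → ℝ) (j : ℕ) (h : Ed d → ℂ) (t : ℝ) :
    Tj μ β j t h = 𝓕⁻ (fun ξ => mj μ β j (t • ξ) * 𝓕 h ξ) := by
  ext x
  rw [Real.fourierInv_eq']
  unfold Tj mj
  congr 1
  ext ξ
  rw [real_inner_comm, smul_eq_mul]
  push_cast
  ring_nf

lemma Tj_continuous (μ : Measure (Ed d)) [IsFiniteMeasure μ] {β : ℝ → ℝ} (hβ : Continuous β)
    (hβsupp : Function.support β ⊆ Ioo (1/2 : ℝ) 2)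
    (j : ℕ) {h : Ed d → ℂ} (hh : Integrable h) {t : ℝ} (ht : 0 < t) :
    Continuous (Tj μ β j t h) := by
  rw [Tj_eq_fourierInv]
  have hi := (mjF_cont μ hβ j hh t).integrable_of_hasCompactSupport (mjF_supp μ hβsupp j h ht)
    (μ := volume)
  have : (𝓕⁻ (fun ξ => mj μ β j (t • ξ) * 𝓕 h ξ)) =
      fun x => 𝓕 (fun ξ => mj μ β j (t • ξ) * 𝓕 h ξ) (-x) := by
    ext x; rw [Real.fourierInv_eq_fourier_neg]
  rw [this]
  exact (fourier_cont hi).comp continuous_neg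

lemma TjStar_measurable (μ : Measure (Ed d)) [IsFiniteMeasure μ] {β : ℝ → ℝ} (hβ : Continuous β)
    (hβsupp : Function.support β ⊆ Ioo (1/2 : ℝ) 2)
    (j : ℕ) {h : Ed d → ℂ} (hh : Integrable h) :
    Measurable (TjStar μ β j h) := by
  have : LowerSemicontinuous (TjStar μ β j h) := by
    unfold TjStar
    apply lowerSemicontinuous_iSup
    intro t
    apply Continuous.lowerSemicontinuous
    have := Tj_continuous μ hβ hβsupp j hh t.2
    fun_prop
  exact this.measurable

lemma exists_psi {β : ℝ → ℝ} (hβsm : ContDiff ℝ (⊤ : ℕ∞) β)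
    (hβsupp : Function.support β ⊆ Ioo (1/2 : ℝ) 2) :
    ∃ ψ : SchwartzMap (Ed d) ℂ, ∀ w, ψ w =
      ∫ ξ, Complex.exp (2 * (π : ℂ) * Complex.I * ((⟪w, ξ⟫ : ℝ) : ℂ)) * ((β ‖ξ‖ : ℝ) : ℂ) := by
  have h1 : HasCompactSupport (fun ξ : Ed d => ((β ‖ξ‖ : ℝ) : ℂ)) := by
    simpa using beta_radial_compact (d := d) hβsupp one_pos
  have h2 : ContDiff ℝ (⊤ : ℕ∞) (fun ξ : Ed d => ((β ‖ξ‖ : ℝ) : ℂ)) := by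
    refine Complex.ofRealCLM.contDiff.comp ?_
    rw [contDiff_iff_contDiffAt]
    intro ξ
    by_cases hξ : ξ = 0
    · have : (fun ξ : Ed d => β ‖ξ‖) =ᶠ[nhds ξ] fun _ => 0 := by
        rw [hξ]
        filter_upwards [Metric.ball_mem_nhds (0 : Ed d) (ε := 1/2) (by norm_num)] with x hx
        apply beta_zero hβsupp
        rw [mem_ball_zero_iff] at hx
        intro h; linarith [h.1]
      exact contDiffAt_const.congr_of_eventuallyEq this
    · exact hβsm.contDiffAt.comp ξ (contDiffAt_norm ℝ hξ)
  refine ⟨𝓕⁻ (h1.toSchwartzMap h2), fun w => ?_⟩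
  rw [SchwartzMap.fourierInv_coe, Real.fourierInv_eq']
  congr 1
  ext ξ
  have : (h1.toSchwartzMap h2) ξ = ((β ‖ξ‖ : ℝ) : ℂ) := rfl
  rw [this, real_inner_comm, smul_eq_mul]
  push_cast
  ring_nf

lemma psi_scale {β : ℝ → ℝ} {ψ : Ed d → ℂ} (hψ : ∀ w, ψ w =
      ∫ ξ, Complex.exp (2 * (π : ℂ) * Complex.I * ((⟪w, ξ⟫ : ℝ) : ℂ)) * ((β ‖ξ‖ : ℝ) : ℂ))
    {δ : ℝ} (hδ : 0 < δ) (w : Ed d) :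
    ∫ ξ, Complex.exp (2 * (π : ℂ) * Complex.I * ((⟪w, ξ⟫ : ℝ) : ℂ)) * ((β (δ * ‖ξ‖) : ℝ) : ℂ)
      = (((δ ^ d)⁻¹ : ℝ) : ℂ) * ψ (δ⁻¹ • w) := by
  have := Measure.integral_comp_smul_of_nonneg (μ := (volume : Measure (Ed d)))
    (fun ξ => Complex.exp (2 * (π : ℂ) * Complex.I * ((⟪δ⁻¹ • w, ξ⟫ : ℝ) : ℂ)) * ((β ‖ξ‖ : ℝ) : ℂ))
    δ (hR := hδ.le)
  rw [← hψ, finrank_euclideanSpace_fin] at this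
  rw [Complex.real_smul] at this
  rw [← this]
  congr 1
  ext ξ
  rw [inner_smul_left, inner_smul_right, norm_smul, Real.norm_of_nonneg hδ.le]
  simp only [conj_trivial]
  rw [← mul_assoc δ⁻¹ δ, inv_mul_cancel₀ hδ.ne', one_mul]

lemma Tj_repr (μ : Measure (Ed d)) [IsFiniteMeasure μ] {β : ℝ → ℝ} (hβ : Continuous β)
    (hβsupp : Function.support β ⊆ Ioo (1/2 : ℝ) 2) {ψ : Ed d → ℂ} (hψc : Continuous ψ)
    (hψb : ∃ B, ∀ w, ‖ψ w‖ ≤ B)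
    (hψ : ∀ w, ψ w =
      ∫ ξ, Complex.exp (2 * (π : ℂ) * Complex.I * ((⟪w, ξ⟫ : ℝ) : ℂ)) * ((β ‖ξ‖ : ℝ) : ℂ))
    (j : ℕ) {h : Ed d → ℂ} (hh : Integrable h) {t : ℝ} (ht : 0 < t) (x : Ed d) :
    Tj μ β j t h x = ∫ y, (∫ z, (((((2:ℝ) ^ (-(j:ℤ)) * t) ^ d)⁻¹ : ℝ) : ℂ) *
      ψ (((2:ℝ) ^ (-(j:ℤ)) * t)⁻¹ • (x - t • y - z)) * h z) ∂μ := by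
  set δ := (2:ℝ) ^ (-(j:ℤ)) * t with hδ
  have hδ0 : 0 < δ := by positivity
  let Φ : Ed d → (Ed d × Ed d) → ℂ := fun ξ yz =>
    Complex.exp (2 * (π : ℂ) * Complex.I * ((⟪x - t • yz.1 - yz.2, ξ⟫ : ℝ) : ℂ)) *
      ((β (δ * ‖ξ‖) : ℝ) : ℂ) * h yz.2
  have e1 : ∀ ξ, Complex.exp (2 * (π : ℂ) * Complex.I * ((⟪x, ξ⟫ : ℝ) : ℂ)) *
    (((β ((2:ℝ) ^ (-(j:ℤ)) * ‖t • ξ‖) : ℝ) : ℂ) * mFT μ (t • ξ)) * 𝓕 h ξ =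
      ∫ yz, Φ ξ yz ∂(μ.prod volume) := by
    intro ξ
    rw [Real.fourier_eq']
    unfold mFT
    have : ∀ yz : Ed d × Ed d, Φ ξ yz = (Complex.exp (2 * (π : ℂ) * Complex.I * ((⟪x, ξ⟫ : ℝ) : ℂ))
        * ((β (δ * ‖ξ‖) : ℝ) : ℂ)) *
        (Complex.exp (-(2 * (π : ℂ) * Complex.I * ((⟪yz.1, t • ξ⟫ : ℝ) : ℂ))) *
        (Complex.exp (((-2 * π * ⟪yz.2, ξ⟫ : ℝ) : ℂ) * Complex.I) • h yz.2)) := by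
      intro yz
      have hexp : Complex.exp (2 * (π : ℂ) * Complex.I * ((⟪x - t • yz.1 - yz.2, ξ⟫ : ℝ) : ℂ)) =
          Complex.exp (2 * (π : ℂ) * Complex.I * ((⟪x, ξ⟫ : ℝ) : ℂ)) *
          Complex.exp (-(2 * (π : ℂ) * Complex.I * ((⟪yz.1, t • ξ⟫ : ℝ) : ℂ))) *
          Complex.exp (((-2 * π * ⟪yz.2, ξ⟫ : ℝ) : ℂ) * Complex.I) := by
        rw [← Complex.exp_add, ← Complex.exp_add]
        congr 1
        simp only [inner_sub_left, inner_smul_left, inner_smul_right, conj_trivial]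
        push_cast
        ring
      simp only [Φ]
      rw [hexp, smul_eq_mul]
      ring
    simp_rw [this]
    rw [integral_const_mul, integral_prod_mul (μ := μ) (ν := (volume : Measure (Ed d)))
      (f := fun y : Ed d => Complex.exp (-(2 * (π : ℂ) * Complex.I * ((⟪y, t • ξ⟫ : ℝ) : ℂ))))
      (g := fun z : Ed d => (Complex.exp (((-2 * π * ⟪z, ξ⟫ : ℝ) : ℂ) * Complex.I) • h z))]
    rw [norm_smul, Real.norm_of_nonneg ht.le, ← mul_assoc ((2:ℝ) ^ (-(j:ℤ)))]
    ring
  have hIntg : Integrable (Function.uncurry Φ) (volume.prod (μ.prod volume)) := by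
    have i1 : Integrable (fun ξ : Ed d => ((β (δ * ‖ξ‖) : ℝ) : ℂ)) :=
      Continuous.integrable_of_hasCompactSupport (by fun_prop) (beta_radial_compact hβsupp hδ0)
    have i2 : Integrable (fun yz : Ed d × Ed d => (1 : ℂ) * h yz.2) (μ.prod volume) :=
      (integrable_const (1 : ℂ)).mul_prod hh
    have i3 := i1.mul_prod i2
    refine i3.mono ?_ ?_
    · refine AEStronglyMeasurable.mul ?_ ?_
      · apply Continuous.aestronglyMeasurable
        fun_prop
      · have i4 : AEStronglyMeasurable (fun yz : Ed d × Ed d => h yz.2) (μ.prod volume) :=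
          i2.1.congr (by filter_upwards with a; simp)
        exact i4.comp_snd (μ := (volume : Measure (Ed d)))
    · filter_upwards with a
      simp only [Function.uncurry, Φ, norm_mul, norm_exp_I]
      simp
  unfold Tj
  simp_rw [e1]
  rw [integral_integral_swap hIntg]
  have e2 : ∀ yz : Ed d × Ed d, ∫ ξ, Φ ξ yz = (((δ ^ d)⁻¹ : ℝ) : ℂ) *
      ψ (δ⁻¹ • (x - t • yz.1 - yz.2)) * h yz.2 := by
    intro yz
    simp only [Φ]
    rw [integral_mul_const, psi_scale hψ hδ0]
  simp_rw [e2]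
  obtain ⟨B, hB⟩ := hψb
  have hIntg2 : Integrable (fun yz : Ed d × Ed d => (((δ ^ d)⁻¹ : ℝ) : ℂ) *
      ψ (δ⁻¹ • (x - t • yz.1 - yz.2)) * h yz.2) (μ.prod volume) := by
    have i2 : Integrable (fun yz : Ed d × Ed d => h yz.2) (μ.prod volume) := by
      simpa using (integrable_const (1 : ℂ)).mul_prod (μ := μ) hh
    refine i2.bdd_mul (c := ‖(((δ ^ d)⁻¹ : ℝ) : ℂ)‖ * B) ?_ ?_
    · apply Continuous.aestronglyMeasurable
      fun_prop
    · filter_upwards with a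
      rw [norm_mul]
      gcongr
      exact hB _
  rw [integral_prod _ hIntg2]



/-! ### The atom estimate -/

lemma schwartz_decay (ψ : SchwartzMap (Ed d) ℂ) (k n : ℕ) :
    ∃ B : ℝ, 0 ≤ B ∧ ∀ w, (1 + ‖w‖) ^ k * ‖iteratedFDeriv ℝ n ψ w‖ ≤ B := by
  have h := fun w => SchwartzMap.one_add_le_sup_seminorm_apply (𝕜 := ℝ) (m := (k, n)) (k := k) (n := n)
    le_rfl le_rfl ψ w
  refine ⟨_, ?_, h⟩
  exact le_trans (by positivity) (h 0)

lemma schwartz_decay0 (ψ : SchwartzMap (Ed d) ℂ) (k : ℕ) :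
    ∃ B : ℝ, 0 ≤ B ∧ ∀ w, (1 + ‖w‖) ^ k * ‖ψ w‖ ≤ B := by
  simpa using schwartz_decay ψ k 0

lemma schwartz_decay1 (ψ : SchwartzMap (Ed d) ℂ) (k : ℕ) :
    ∃ B : ℝ, 0 ≤ B ∧ ∀ w, (1 + ‖w‖) ^ k * ‖fderiv ℝ ψ w‖ ≤ B := by
  have := schwartz_decay ψ k 1
  simpa [norm_iteratedFDeriv_one] using this

lemma integrable_jap {k : ℕ} (hk : d < k) : Integrable (fun w : Ed d => ((1 + ‖w‖) ^ k)⁻¹) := by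
  have := integrable_one_add_norm (E := Ed d) (μ := volume) (r := (k : ℝ))
    (by rw [finrank_euclideanSpace_fin]; exact_mod_cast hk)
  refine this.congr ?_
  filter_upwards with w
  rw [Real.rpow_neg (by positivity), Real.rpow_natCast]

lemma schwartz_int (ψ : SchwartzMap (Ed d) ℂ) (k : ℕ) :
    Integrable (fun w => ‖ψ w‖ * (1 + ‖w‖) ^ k) := by
  obtain ⟨B, hB0, hB⟩ := schwartz_decay0 ψ (k + (d + 1))
  refine ((integrable_jap (d := d) (k := d + 1) (by omega)).const_mul B).mono' ?_ ?_
  · apply Continuous.aestronglyMeasurable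
    have := ψ.continuous
    fun_prop
  · filter_upwards with w
    rw [Real.norm_of_nonneg (by positivity), ← div_eq_mul_inv, le_div_iff₀ (by positivity)]
    have := hB w
    rw [pow_add] at this
    linarith

lemma atom_case1 (ψ : SchwartzMap (Ed d) ℂ) :
    ∃ K : ℝ, 0 ≤ K ∧ ∀ (h : Ed d → ℂ) (c : Ed d) (r A δ : ℝ), 0 < r → 0 ≤ A → 0 < δ → δ ≤ r →
      Integrable h → (∀ z, ‖h z‖ ≤ A) → (∀ z ∉ closedBall c r, h z = 0) →
      ∀ v, ‖∫ z, (((δ ^ d)⁻¹ : ℝ) : ℂ) * ψ (δ⁻¹ • (v - z)) * h z‖ ≤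
        K * A * ((1 + ‖v - c‖ / r) ^ (d + 1))⁻¹ := by
  refine ⟨2 ^ (d + 1) * ∫ w, ‖ψ w‖ * (1 + ‖w‖) ^ (d + 1), by positivity, ?_⟩
  intro h c r A δ hr hA hδ hδr hh hhA hsupp v
  have hIntg := schwartz_int ψ (d + 1)
  have e1 : ∫ z, (δ ^ d)⁻¹ * (‖ψ (δ⁻¹ • (v - z))‖ * (1 + ‖δ⁻¹ • (v - z)‖) ^ (d + 1)) =
      ∫ w, ‖ψ w‖ * (1 + ‖w‖) ^ (d + 1) := by
    rw [integral_const_mul]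
    rw [integral_sub_left_eq_self (fun z => ‖ψ (δ⁻¹ • z)‖ * (1 + ‖δ⁻¹ • z‖) ^ (d + 1)) volume v]
    rw [Measure.integral_comp_smul_of_nonneg (μ := (volume : Measure (Ed d)))
      (fun w => ‖ψ w‖ * (1 + ‖w‖) ^ (d + 1)) δ⁻¹ (hR := by positivity)]
    rw [finrank_euclideanSpace_fin, smul_eq_mul, ← mul_assoc]
    rw [inv_pow, inv_inv, inv_mul_cancel₀ (by positivity), one_mul]
  have i1 : Integrable
      (fun z => (δ ^ d)⁻¹ * (‖ψ (δ⁻¹ • (v - z))‖ * (1 + ‖δ⁻¹ • (v - z)‖) ^ (d + 1))) := by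
    refine Integrable.const_mul ?_ _
    have := (hIntg.comp_smul (R := δ⁻¹) (by positivity)).comp_sub_left v
    exact this
  calc ‖∫ z, (((δ ^ d)⁻¹ : ℝ) : ℂ) * ψ (δ⁻¹ • (v - z)) * h z‖
      ≤ ∫ z, (2 ^ (d + 1) * A * ((1 + ‖v - c‖ / r) ^ (d + 1))⁻¹) *
        ((δ ^ d)⁻¹ * (‖ψ (δ⁻¹ • (v - z))‖ * (1 + ‖δ⁻¹ • (v - z)‖) ^ (d + 1))) := by
        apply norm_integral_le_of_norm_le (i1.const_mul _)
        filter_upwards with z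
        by_cases hz : z ∈ closedBall c r
        · rw [norm_mul, norm_mul, Complex.norm_of_nonneg (by positivity)]
          have hz' : ‖z - c‖ ≤ r := by simpa [dist_eq_norm] using hz
          have key : (1 + ‖v - c‖ / r) ^ (d + 1) ≤
              2 ^ (d + 1) * (1 + ‖δ⁻¹ • (v - z)‖) ^ (d + 1) := by
            rw [← mul_pow]
            gcongr
            rw [norm_smul, norm_inv, Real.norm_of_nonneg hδ.le]
            have h1 : ‖v - c‖ ≤ ‖v - z‖ + r := by
              calc ‖v - c‖ = ‖(v - z) + (z - c)‖ := by congr 1; abel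
                _ ≤ _ := (norm_add_le _ _).trans (by gcongr)
            have h2 : ‖v - c‖ / r ≤ ‖v - z‖ / δ + 1 := by
              calc ‖v - c‖ / r ≤ (‖v - z‖ + r) / r := by gcongr
                _ = ‖v - z‖ / r + 1 := by field_simp
                _ ≤ _ := by gcongr
            have h3 : δ⁻¹ * ‖v - z‖ = ‖v - z‖ / δ := by ring
            rw [h3]
            have : 0 ≤ ‖v - z‖ / δ := by positivity
            linarith
          have key2 : 1 ≤ (2 ^ (d + 1) * (1 + ‖δ⁻¹ • (v - z)‖) ^ (d + 1)) *
              ((1 + ‖v - c‖ / r) ^ (d + 1))⁻¹ := by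
            rw [← div_eq_mul_inv, le_div_iff₀ (by positivity), one_mul]
            exact key
          calc (δ ^ d)⁻¹ * ‖ψ (δ⁻¹ • (v - z))‖ * ‖h z‖
              ≤ ((δ ^ d)⁻¹ * ‖ψ (δ⁻¹ • (v - z))‖ * A) * 1 := by
                rw [mul_one]; gcongr; exact hhA z
            _ ≤ ((δ ^ d)⁻¹ * ‖ψ (δ⁻¹ • (v - z))‖ * A) *
                ((2 ^ (d + 1) * (1 + ‖δ⁻¹ • (v - z)‖) ^ (d + 1)) *
                  ((1 + ‖v - c‖ / r) ^ (d + 1))⁻¹) := by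
                gcongr
            _ = _ := by ring
        · rw [hsupp z hz]
          simp only [mul_zero, norm_zero]
          positivity
    _ = _ := by
        rw [integral_const_mul, e1]
        ring

lemma atom_case2 (ψ : SchwartzMap (Ed d) ℂ) :
    ∃ K : ℝ, 0 ≤ K ∧ ∀ (h : Ed d → ℂ) (c : Ed d) (r A δ : ℝ), 0 < r → 0 ≤ A → 0 < δ → r ≤ δ →
      Integrable h → (∀ z, ‖h z‖ ≤ A) → (∀ z ∉ closedBall c r, h z = 0) → ∫ z, h z = 0 →
      ∀ v, ‖∫ z, (((δ ^ d)⁻¹ : ℝ) : ℂ) * ψ (δ⁻¹ • (v - z)) * h z‖ ≤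
        K * A * (r / δ) ^ (d + 1) * ((1 + ‖v - c‖ / δ) ^ (d + 1))⁻¹ := by
  obtain ⟨G, hG0, hG⟩ := schwartz_decay1 ψ (d + 1)
  obtain ⟨B, hB0, hB⟩ := schwartz_decay0 ψ 0
  refine ⟨2 ^ (d + 1) * G * (volume.real (ball (0 : Ed d) 1)), by positivity, ?_⟩
  intro h c r A δ hr hA hδ hδr hh hhA hsupp hzero v
  set a0 : ℂ := (((δ ^ d)⁻¹ : ℝ) : ℂ) with ha0
  have i1 : Integrable (fun z => a0 * ψ (δ⁻¹ • (v - z)) * h z) := by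
    refine hh.bdd_mul (c := ‖a0‖ * B) ?_ ?_
    · apply Continuous.aestronglyMeasurable
      have := ψ.continuous
      fun_prop
    · filter_upwards with z
      rw [norm_mul]
      gcongr
      simpa using hB (δ⁻¹ • (v - z))
  have i2 : Integrable (fun z => a0 * ψ (δ⁻¹ • (v - c)) * h z) := hh.const_mul _
  have e0 : ∫ z, a0 * ψ (δ⁻¹ • (v - z)) * h z =
      ∫ z in closedBall c r, a0 * (ψ (δ⁻¹ • (v - z)) - ψ (δ⁻¹ • (v - c))) * h z := by
    have : ∫ z, a0 * ψ (δ⁻¹ • (v - c)) * h z = 0 := by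
      rw [integral_const_mul, hzero, mul_zero]
    rw [← sub_zero (∫ z, a0 * ψ (δ⁻¹ • (v - z)) * h z), ← this, ← integral_sub i1 i2]
    rw [setIntegral_eq_integral_of_forall_compl_eq_zero]
    · congr 1; ext z; ring
    · intro z hz
      rw [hsupp z hz, mul_zero]
  rw [e0]
  have hvol : volume.real (closedBall c r) = r ^ d * volume.real (ball (0 : Ed d) 1) := by
    have := Measure.addHaar_real_closedBall (volume : Measure (Ed d)) c hr.le
    rw [this, finrank_euclideanSpace_fin]
  have bound : ∀ z ∈ closedBall c r, ‖a0 * (ψ (δ⁻¹ • (v - z)) - ψ (δ⁻¹ • (v - c))) * h z‖ ≤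
      (δ ^ d)⁻¹ * (2 ^ (d + 1) * G * ((1 + ‖v - c‖ / δ) ^ (d + 1))⁻¹ * (r / δ)) * A := by
    intro z hz
    have hz' : ‖z - c‖ ≤ r := by simpa [dist_eq_norm] using hz
    rw [norm_mul, norm_mul, ha0, Complex.norm_of_nonneg (by positivity)]
    gcongr
    · have hw : ∀ w ∈ closedBall (δ⁻¹ • (v - c)) 1, ‖fderiv ℝ ψ w‖ ≤
          2 ^ (d + 1) * G * ((1 + ‖v - c‖ / δ) ^ (d + 1))⁻¹ := by
        intro w hw
        rw [← div_eq_mul_inv, le_div_iff₀ (by positivity)]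
        have hw' : ‖δ⁻¹ • (v - c) - w‖ ≤ 1 := by
          rw [← dist_eq_norm, dist_comm]; exact hw
        have h1 : ‖v - c‖ / δ ≤ ‖w‖ + 1 := by
          calc ‖v - c‖ / δ = ‖δ⁻¹ • (v - c)‖ := by
                rw [norm_smul, norm_inv, Real.norm_of_nonneg hδ.le]; ring
            _ = ‖w + (δ⁻¹ • (v - c) - w)‖ := by congr 1; abel
            _ ≤ _ := (norm_add_le _ _).trans (by gcongr)
        calc ‖fderiv ℝ ψ w‖ * (1 + ‖v - c‖ / δ) ^ (d + 1)
            ≤ ‖fderiv ℝ ψ w‖ * (2 * (1 + ‖w‖)) ^ (d + 1) := by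
              gcongr
              have := norm_nonneg w
              linarith
          _ = 2 ^ (d + 1) * ((1 + ‖w‖) ^ (d + 1) * ‖fderiv ℝ ψ w‖) := by rw [mul_pow]; ring
          _ ≤ _ := by gcongr; exact hG w
      have hdist : ‖δ⁻¹ • (v - z) - δ⁻¹ • (v - c)‖ ≤ r / δ := by
        rw [← smul_sub, norm_smul, norm_inv, Real.norm_of_nonneg hδ.le]
        have : v - z - (v - c) = -(z - c) := by abel
        rw [this, norm_neg, div_eq_inv_mul]
        gcongr
      have hr1 : r / δ ≤ 1 := by rw [div_le_one hδ]; exact hδr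
      have := (convex_closedBall (δ⁻¹ • (v - c)) 1).norm_image_sub_le_of_norm_fderiv_le (𝕜 := ℝ)
        (f := ψ) (fun w _ => ψ.differentiableAt) hw
        (x := δ⁻¹ • (v - c)) (y := δ⁻¹ • (v - z)) (by simp)
        (by rw [mem_closedBall, dist_eq_norm]; linarith)
      refine this.trans ?_
      gcongr
    · exact hhA z
  refine (norm_setIntegral_le_of_norm_le_const (by exact measure_closedBall_lt_top) bound).trans
    (le_of_eq ?_)
  rw [hvol, div_pow, pow_succ r d, pow_succ δ d]
  field_simp

lemma atom_S (ψ : SchwartzMap (Ed d) ℂ) :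
    ∃ K : ℝ, 0 ≤ K ∧ ∀ (h : Ed d → ℂ) (c : Ed d) (r A δ : ℝ), 0 < r → 0 ≤ A → 0 < δ →
      Integrable h → (∀ z, ‖h z‖ ≤ A) → (∀ z ∉ closedBall c r, h z = 0) → ∫ z, h z = 0 →
      ∀ v, ‖∫ z, (((δ ^ d)⁻¹ : ℝ) : ℂ) * ψ (δ⁻¹ • (v - z)) * h z‖ ≤
        K * A * ((r / (r + δ)) ^ (d + 1) * ((1 + ‖v - c‖ / (r + δ)) ^ (d + 1))⁻¹) := by
  obtain ⟨K1, hK1, h1⟩ := atom_case1 ψ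
  obtain ⟨K2, hK2, h2⟩ := atom_case2 ψ
  refine ⟨2 ^ (d + 1) * (K1 + K2), by positivity, ?_⟩
  intro h c r A δ hr hA hδ hh hhA hsupp hzero v
  rcases le_total δ r with hle | hle
  · refine (h1 h c r A δ hr hA hδ hle hh hhA hsupp v).trans ?_
    have a1 : 1 ≤ 2 ^ (d + 1) * (r / (r + δ)) ^ (d + 1) := by
      rw [← mul_pow]
      apply one_le_pow₀
      rw [mul_div_assoc', le_div_iff₀ (by positivity)]
      linarith
    have a2 : ((1 + ‖v - c‖ / r) ^ (d + 1))⁻¹ ≤ ((1 + ‖v - c‖ / (r + δ)) ^ (d + 1))⁻¹ := by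
      gcongr
      linarith
    calc K1 * A * ((1 + ‖v - c‖ / r) ^ (d + 1))⁻¹
        ≤ (K1 + K2) * A * ((1 + ‖v - c‖ / (r + δ)) ^ (d + 1))⁻¹ * 1 := by
          rw [mul_one]; gcongr; linarith
      _ ≤ (K1 + K2) * A * ((1 + ‖v - c‖ / (r + δ)) ^ (d + 1))⁻¹ *
          (2 ^ (d + 1) * (r / (r + δ)) ^ (d + 1)) := by gcongr
      _ = _ := by ring
  · refine (h2 h c r A δ hr hA hδ hle hh hhA hsupp hzero v).trans ?_
    have a1 : (r / δ) ^ (d + 1) ≤ 2 ^ (d + 1) * (r / (r + δ)) ^ (d + 1) := by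
      rw [← mul_pow]
      gcongr
      rw [mul_div_assoc', div_le_div_iff₀ hδ (by positivity)]
      nlinarith
    have a2 : ((1 + ‖v - c‖ / δ) ^ (d + 1))⁻¹ ≤ ((1 + ‖v - c‖ / (r + δ)) ^ (d + 1))⁻¹ := by
      gcongr
      linarith
    calc K2 * A * (r / δ) ^ (d + 1) * ((1 + ‖v - c‖ / δ) ^ (d + 1))⁻¹
        ≤ (K1 + K2) * A * (2 ^ (d + 1) * (r / (r + δ)) ^ (d + 1)) *
          ((1 + ‖v - c‖ / (r + δ)) ^ (d + 1))⁻¹ := by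
          gcongr; linarith
      _ = _ := by ring




/-! ### The maximal estimate for atoms -/

lemma lintegral_rho {r b : ℝ} (hr : 0 < r) (hb : 0 < b) :
    ∫⁻ s in Ioi (0:ℝ), ENNReal.ofReal (((r + b * s) ^ 2)⁻¹) = ENNReal.ofReal (b⁻¹ * r⁻¹) := by
  have hpos : ∀ s ∈ Ioi (0:ℝ), 0 < r + b * s := fun s hs => by
    have : 0 < b * s := mul_pos hb hs
    linarith
  have hder : ∀ s ∈ Ici (0:ℝ), HasDerivAt (fun s => -(b⁻¹ * (r + b * s)⁻¹))
      (((r + b * s) ^ 2)⁻¹) s := by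
    intro s hs
    have h0 : r + b * s ≠ 0 := by
      have : 0 ≤ b * s := mul_nonneg hb.le hs
      linarith
    have h1 : HasDerivAt (fun s => r + b * s) b s := by
      simpa using ((hasDerivAt_id s).const_mul b).const_add r
    have h2 := ((h1.inv h0).const_mul b⁻¹).neg
    refine HasDerivAt.congr_deriv h2 ?_
    field_simp
  have hlim : Filter.Tendsto (fun s => -(b⁻¹ * (r + b * s)⁻¹)) Filter.atTop (nhds 0) := by
    have : Filter.Tendsto (fun s => r + b * s) Filter.atTop Filter.atTop :=
      Filter.tendsto_atTop_add_const_left _ _ (Filter.Tendsto.const_mul_atTop hb Filter.tendsto_id)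
    simpa using ((this.inv_tendsto_atTop).const_mul b⁻¹).neg
  have hnn : ∀ s ∈ Ioi (0:ℝ), 0 ≤ ((r + b * s) ^ 2)⁻¹ := fun s hs => by positivity
  have hI := integrableOn_Ioi_deriv_of_nonneg' hder hnn hlim
  have hE := integral_Ioi_of_hasDerivAt_of_nonneg' hder hnn hlim
  rw [← ofReal_integral_eq_lintegral_ofReal hI, hE]
  · simp
  · filter_upwards with s
    positivity

lemma lintegral_jap_scale {ρ : ℝ} (hρ : 0 < ρ) (r : ℝ) (hr : 0 ≤ r) (v : Ed d) :
    ∫⁻ x : Ed d, ENNReal.ofReal ((r / (ρ + ‖x - v‖)) ^ (d + 1)) =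
      ENNReal.ofReal (r ^ (d + 1) * ρ⁻¹ * ∫ w : Ed d, ((1 + ‖w‖) ^ (d + 1))⁻¹) := by
  rw [lintegral_sub_right_eq_self (fun x => ENNReal.ofReal ((r / (ρ + ‖x‖)) ^ (d + 1))) v]
  have hi := integrable_jap (d := d) (k := d + 1) (by omega)
  have e : ∀ x : Ed d, (r / (ρ + ‖x‖)) ^ (d + 1) =
      (r ^ (d + 1) * (ρ ^ (d + 1))⁻¹) * ((1 + ‖ρ⁻¹ • x‖) ^ (d + 1))⁻¹ := by
    intro x
    rw [norm_smul, norm_inv, Real.norm_of_nonneg hρ.le, mul_assoc, ← mul_inv, ← mul_pow,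
      ← div_eq_mul_inv, ← div_pow]
    congr 2
    field_simp
  simp_rw [e]
  rw [← ofReal_integral_eq_lintegral_ofReal]
  · rw [integral_const_mul, Measure.integral_comp_smul_of_nonneg (μ := (volume : Measure (Ed d)))
      (fun w => ((1 + ‖w‖) ^ (d + 1))⁻¹) ρ⁻¹ (hR := by positivity)]
    rw [finrank_euclideanSpace_fin, smul_eq_mul]
    congr 1
    rw [pow_succ ρ d, inv_pow, inv_inv]
    field_simp
  · exact (hi.comp_smul (R := ρ⁻¹) (by positivity)).const_mul _
  · filter_upwards with x
    positivity

lemma slow_var {R b r t : ℝ} (hR : 0 ≤ R) (hb : 0 < b) (hb1 : b ≤ 1) (hr : 0 < r) (ht : 0 < t)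
    {x y c : Ed d} (hy : ‖y‖ ≤ R) :
    ENNReal.ofReal ((r / (r + b * t + ‖x - t • y - c‖)) ^ (d + 1)) ≤
      ENNReal.ofReal (2 * (2 + R) ^ (d + 1)) *
      ∫⁻ s in Ioi (0:ℝ), ENNReal.ofReal ((r / (r + b * s + ‖x - s • y - c‖)) ^ (d + 1) *
        (r + b * s)⁻¹) := by
  set ρ := r + b * t with hρ
  have hρ0 : 0 < ρ := by positivity
  have hsub : Icc t (t + ρ) ⊆ Ioi (0:ℝ) := fun s hs => lt_of_lt_of_le ht hs.1
  rw [← lintegral_const_mul' _ _ ENNReal.ofReal_ne_top]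
  calc ENNReal.ofReal ((r / (ρ + ‖x - t • y - c‖)) ^ (d + 1))
      = ∫⁻ s in Icc t (t + ρ), ENNReal.ofReal ((r / (ρ + ‖x - t • y - c‖)) ^ (d + 1) * ρ⁻¹) := by
        rw [lintegral_const, Measure.restrict_apply MeasurableSet.univ, univ_inter, Real.volume_Icc,
          ← ENNReal.ofReal_mul (by positivity)]
        congr 1
        field_simp
        ring
    _ ≤ ∫⁻ s in Icc t (t + ρ), ENNReal.ofReal (2 * (2 + R) ^ (d + 1)) *
        ENNReal.ofReal ((r / (r + b * s + ‖x - s • y - c‖)) ^ (d + 1) * (r + b * s)⁻¹) := by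
        apply setLIntegral_mono' measurableSet_Icc
        intro s hs
        rw [← ENNReal.ofReal_mul (by positivity)]
        apply ENNReal.ofReal_le_ofReal
        have hs0 : 0 < s := hsub hs
        have hρs : r + b * s ≤ 2 * ρ := by
          have : b * s ≤ b * t + ρ := by
            calc b * s ≤ b * (t + ρ) := by gcongr; exact hs.2
              _ = b * t + b * ρ := by ring
              _ ≤ b * t + 1 * ρ := by gcongr
              _ = _ := by ring
          linarith
        have hst : ‖x - s • y - c‖ ≤ ‖x - t • y - c‖ + R * ρ := by
          have e : x - s • y - c = (x - t • y - c) - (s - t) • y := by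
            rw [sub_smul]; abel
          rw [e]
          refine (norm_sub_le _ _).trans ?_
          gcongr
          have hs1 : 0 ≤ s - t := sub_nonneg.2 hs.1
          rw [norm_smul, Real.norm_of_nonneg hs1, mul_comm]
          gcongr
          have := hs.2; linarith
        have h1 : r / (ρ + ‖x - t • y - c‖) ≤ (2 + R) * (r / (r + b * s + ‖x - s • y - c‖)) := by
          rw [mul_div_assoc', div_le_div_iff₀ (by positivity) (by positivity)]
          have : r + b * s + ‖x - s • y - c‖ ≤ (2 + R) * (ρ + ‖x - t • y - c‖) := by
            have := norm_nonneg (x - t • y - c)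
            nlinarith
          nlinarith
        have h2 : ρ⁻¹ ≤ 2 * (r + b * s)⁻¹ := by
          rw [← div_eq_mul_inv, ← one_div, div_le_div_iff₀ (by positivity) (by positivity)]
          linarith
        calc (r / (ρ + ‖x - t • y - c‖)) ^ (d + 1) * ρ⁻¹
            ≤ ((2 + R) * (r / (r + b * s + ‖x - s • y - c‖))) ^ (d + 1) *
              (2 * (r + b * s)⁻¹) := by gcongr
          _ = _ := by rw [mul_pow]; ring
    _ ≤ _ := lintegral_mono_set hsub

set_option maxHeartbeats 1000000 in
lemma atom_star (μ : Measure (Ed d)) [IsFiniteMeasure μ]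
    (hcomp : ∃ K : Set (Ed d), IsCompact K ∧ μ Kᶜ = 0) {β : ℝ → ℝ}
    (hβsm : ContDiff ℝ (⊤ : ℕ∞) β) (hβsupp : Function.support β ⊆ Ioo (1/2 : ℝ) 2) :
    ∃ C : ℝ, 0 ≤ C ∧ ∀ (j : ℕ) (h : Ed d → ℂ) (c : Ed d) (r A : ℝ), 0 < r → 0 ≤ A →
      Integrable h → (∀ z, ‖h z‖ ≤ A) → (∀ z ∉ closedBall c r, h z = 0) → ∫ z, h z = 0 →
      ∫⁻ x, TjStar μ β j h x ≤ ENNReal.ofReal (C * 2 ^ j * A * r ^ d) := by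
  obtain ⟨S, hS, hSμ⟩ := hcomp
  obtain ⟨R0, hR0⟩ := hS.isBounded.exists_norm_le
  obtain ⟨R, hR, hRμ⟩ : ∃ R : ℝ, 0 ≤ R ∧ ∀ᵐ y ∂μ, ‖y‖ ≤ R := by
    refine ⟨max R0 0, le_max_right _ _, ?_⟩
    have : ∀ᵐ y ∂μ, y ∈ S := by
      rw [ae_iff]; exact hSμ
    filter_upwards [this] with y hy
    exact (hR0 y hy).trans (le_max_left _ _)
  obtain ⟨ψ, hψ⟩ := exists_psi (d := d) hβsm hβsupp
  obtain ⟨K, hK0, hK⟩ := atom_S ψ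
  set J := ∫ w : Ed d, ((1 + ‖w‖) ^ (d + 1))⁻¹ with hJ
  have hJ0 : 0 ≤ J := integral_nonneg (fun w => by positivity)
  refine ⟨μ.real univ * (K * (2 * (2 + R) ^ (d + 1)) * J), by positivity, ?_⟩
  intro j h c r A hr hA hh hhA hsupp hzero
  set b := (2:ℝ) ^ (-(j:ℤ)) with hb
  have hb0 : 0 < b := by positivity
  have hb1 : b ≤ 1 := by
    rw [hb, zpow_neg, zpow_natCast]
    exact inv_le_one_of_one_le₀ (one_le_pow₀ (by norm_num))
  have hψb : ∃ B, ∀ w, ‖ψ w‖ ≤ B := by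
    obtain ⟨B, _, hB⟩ := schwartz_decay0 ψ 0
    exact ⟨B, fun w => by simpa using hB w⟩
  set P : Ed d → Ed d → ℝ → ℝ≥0∞ := fun x y s =>
    ENNReal.ofReal ((r / (r + b * s + ‖x - s • y - c‖)) ^ (d + 1) * (r + b * s)⁻¹) with hP
  set L := ENNReal.ofReal (K * A) * ENNReal.ofReal (2 * (2 + R) ^ (d + 1)) with hL
  have hLtop : L ≠ ⊤ := ENNReal.mul_ne_top ENNReal.ofReal_ne_top ENNReal.ofReal_ne_top
  have pt : ∀ x, TjStar μ β j h x ≤ L * ∫⁻ y, (∫⁻ s in Ioi (0:ℝ), P x y s) ∂μ := by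
    intro x
    refine iSup_le fun t => ?_
    obtain ⟨t, ht⟩ := t
    rw [Tj_repr μ hβsm.continuous hβsupp ψ.continuous hψb hψ j hh ht x]
    refine (enorm_integral_le_lintegral_enorm _).trans ?_
    rw [← lintegral_const_mul' _ _ hLtop]
    apply lintegral_mono_ae
    filter_upwards [hRμ] with y hy
    have h1 := hK h c r A (b * t) hr hA (by positivity) hh hhA hsupp hzero (x - t • y)
    rw [← ofReal_norm]
    refine (ENNReal.ofReal_le_ofReal h1).trans ?_
    rw [ENNReal.ofReal_mul (by positivity), hL, mul_assoc]
    gcongr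
    refine le_trans (le_of_eq ?_) (slow_var hR hb0 hb1 hr ht hy)
    rw [← inv_pow, ← mul_pow]
    congr 2
    have : 0 < r + b * t := by positivity
    field_simp
  have hPm : Measurable (fun q : (Ed d × Ed d) × ℝ => P q.1.1 q.1.2 q.2) := by
    simp only [hP]
    apply ENNReal.measurable_ofReal.comp
    fun_prop
  calc ∫⁻ x, TjStar μ β j h x ≤ ∫⁻ x, L * ∫⁻ y, (∫⁻ s in Ioi (0:ℝ), P x y s) ∂μ := lintegral_mono pt
    _ = L * ∫⁻ x, ∫⁻ y, (∫⁻ s in Ioi (0:ℝ), P x y s) ∂μ := lintegral_const_mul' _ _ hLtop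
    _ = L * ∫⁻ y, (∫⁻ x, ∫⁻ s in Ioi (0:ℝ), P x y s) ∂μ := by
        rw [lintegral_lintegral_swap]
        exact (hPm.lintegral_prod_right' (ν := volume.restrict (Ioi (0:ℝ)))).aemeasurable
    _ = L * ∫⁻ y, ENNReal.ofReal (J * 2 ^ j * r ^ d) ∂μ := by
        congr 2
        ext y
        rw [lintegral_lintegral_swap]
        · calc ∫⁻ s in Ioi (0:ℝ), ∫⁻ x, P x y s
              = ∫⁻ s in Ioi (0:ℝ), ENNReal.ofReal (r ^ (d + 1) * J) *
                ENNReal.ofReal (((r + b * s) ^ 2)⁻¹) := by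
                apply setLIntegral_congr_fun measurableSet_Ioi
                intro s hs
                have hs' : 0 < s := hs
                have hρ : 0 < r + b * s := by positivity
                simp only [hP]
                simp_rw [ENNReal.ofReal_mul' (inv_nonneg.2 hρ.le), sub_sub]
                rw [lintegral_mul_const' _ _ ENNReal.ofReal_ne_top,
                  lintegral_jap_scale hρ r hr.le, ← ENNReal.ofReal_mul (by positivity),
                  ← ENNReal.ofReal_mul (by positivity)]
                congr 1
                rw [← hJ]
                field_simp
            _ = _ := by
                rw [lintegral_const_mul' _ _ ENNReal.ofReal_ne_top, lintegral_rho hr hb0,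
                  ← ENNReal.ofReal_mul (by positivity)]
                congr 1
                rw [hb, zpow_neg, inv_inv, zpow_natCast, pow_succ]
                field_simp
        · apply Measurable.aemeasurable
          exact hPm.comp (f := fun q : Ed d × ℝ => ((q.1, y), q.2)) (by fun_prop)
    _ = _ := by
        rw [lintegral_const, hL, ← ENNReal.ofReal_mul (by positivity),
          ← ofReal_measureReal (μ := μ) (s := univ), ← ENNReal.ofReal_mul (by positivity),
          ← ENNReal.ofReal_mul (by positivity)]
        congr 1
        ring



/-! ### Decay of the multiplier and its radial derivative -/

lemma mFT_decay (μ : Measure (Ed d)) [IsFiniteMeasure μ] {a C : ℝ} (ha : 0 < a)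
    (hdecay : ∀ ξ : Ed d, ξ ≠ 0 → ‖mFT μ ξ‖ ≤ C * ‖ξ‖ ^ (-a)) :
    ∃ C₁ : ℝ, 0 ≤ C₁ ∧ ∀ ξ, ‖mFT μ ξ‖ ≤ C₁ * (1 + ‖ξ‖) ^ (-a) := by
  refine ⟨(μ.real univ + |C|) * 2 ^ a, by positivity, fun ξ => ?_⟩
  have key : ∀ x : ℝ, 0 < x → 1 + ‖ξ‖ ≤ 2 * x → x ^ (-a) ≤ 2 ^ a * (1 + ‖ξ‖) ^ (-a) := by
    intro x hx h
    have h1 : (2 * x) ^ (-a) ≤ (1 + ‖ξ‖) ^ (-a) :=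
      Real.rpow_le_rpow_of_nonpos (by positivity) h (by linarith)
    rw [Real.mul_rpow (by norm_num) hx.le] at h1
    calc x ^ (-a) = 2 ^ a * (2 ^ (-a) * x ^ (-a)) := by
          rw [← mul_assoc, ← Real.rpow_add (by norm_num)]; simp
      _ ≤ _ := by gcongr
  rcases le_total ‖ξ‖ 1 with h | h
  · have := key 1 one_pos (by linarith)
    rw [Real.one_rpow] at this
    calc ‖mFT μ ξ‖ ≤ (μ.real univ + |C|) * 1 := by
          have := mFT_norm_le μ ξ
          have := abs_nonneg C
          linarith
      _ ≤ (μ.real univ + |C|) * (2 ^ a * (1 + ‖ξ‖) ^ (-a)) := by gcongr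
      _ = _ := by ring
  · have h0 : 0 < ‖ξ‖ := by linarith
    have := key ‖ξ‖ h0 (by linarith)
    calc ‖mFT μ ξ‖ ≤ C * ‖ξ‖ ^ (-a) := hdecay ξ (norm_pos_iff.1 h0)
      _ ≤ (μ.real univ + |C|) * ‖ξ‖ ^ (-a) := by
          gcongr
          have := le_abs_self C
          have : 0 ≤ μ.real univ := measureReal_nonneg
          linarith
      _ ≤ (μ.real univ + |C|) * (2 ^ a * (1 + ‖ξ‖) ^ (-a)) := by gcongr
      _ = _ := by ring

lemma peetre {a : ℝ} (ha : 0 < a) {k : ℕ} (hk : a ≤ k) (ξ ω : Ed d) :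
    (1 + ‖ξ - ω‖) ^ (-a) ≤ (1 + ‖ω‖) ^ k * (1 + ‖ξ‖) ^ (-a) := by
  have h1 : 1 + ‖ξ‖ ≤ (1 + ‖ξ - ω‖) * (1 + ‖ω‖) := by
    have : ‖ξ‖ ≤ ‖ξ - ω‖ + ‖ω‖ := by
      calc ‖ξ‖ = ‖(ξ - ω) + ω‖ := by congr 1; abel
        _ ≤ _ := norm_add_le _ _
    have := mul_nonneg (norm_nonneg (ξ - ω)) (norm_nonneg ω)
    nlinarith
  have h2 : ((1 + ‖ξ - ω‖) * (1 + ‖ω‖)) ^ (-a) ≤ (1 + ‖ξ‖) ^ (-a) :=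
    Real.rpow_le_rpow_of_nonpos (by positivity) h1 (by linarith)
  rw [Real.mul_rpow (by positivity) (by positivity)] at h2
  have h3 : (1 + ‖ω‖) ^ a ≤ (1 + ‖ω‖) ^ k := by
    rw [← Real.rpow_natCast]
    apply Real.rpow_le_rpow_of_exponent_le
    · linarith [norm_nonneg ω]
    · exact hk
  calc (1 + ‖ξ - ω‖) ^ (-a) = (1 + ‖ω‖) ^ a * ((1 + ‖ξ - ω‖) ^ (-a) * (1 + ‖ω‖) ^ (-a)) := by
        rw [mul_comm ((1 + ‖ξ - ω‖) ^ (-a)), ← mul_assoc, ← Real.rpow_add (by positivity)]; simp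
    _ ≤ _ := by gcongr

lemma twisted_decay (μ : Measure (Ed d)) [IsFiniteMeasure μ] {a C₁ : ℝ} (ha : 0 < a)
    (hC₁ : 0 ≤ C₁) (hdec : ∀ ξ, ‖mFT μ ξ‖ ≤ C₁ * (1 + ‖ξ‖) ^ (-a)) (χ : SchwartzMap (Ed d) ℂ) :
    ∃ C₂ : ℝ, 0 ≤ C₂ ∧ ∀ ξ : Ed d,
      ‖∫ x, χ x * Complex.exp (-(2 * (π : ℂ) * Complex.I * ((⟪x, ξ⟫ : ℝ) : ℂ))) ∂μ‖ ≤
        C₂ * (1 + ‖ξ‖) ^ (-a) := by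
  obtain ⟨k, hk⟩ := exists_nat_ge a
  set η : SchwartzMap (Ed d) ℂ := 𝓕 χ with hη
  have hinv : ∀ x, χ x = ∫ ω, Complex.exp (2 * (π : ℂ) * Complex.I * ((⟪x, ω⟫ : ℝ) : ℂ)) * η ω := by
    intro x
    have : χ = 𝓕⁻ η := by rw [hη, FourierTransform.fourierInv_fourier_eq]
    rw [this, SchwartzMap.fourierInv_coe, Real.fourierInv_eq']
    congr 1
    ext ω
    rw [real_inner_comm, smul_eq_mul]
    push_cast
    ring_nf
  have hi := schwartz_int η k
  refine ⟨C₁ * ∫ ω, ‖η ω‖ * (1 + ‖ω‖) ^ k, by positivity, fun ξ => ?_⟩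
  have e : ∫ x, χ x * Complex.exp (-(2 * (π : ℂ) * Complex.I * ((⟪x, ξ⟫ : ℝ) : ℂ))) ∂μ =
      ∫ ω, η ω * mFT μ (ξ - ω) := by
    simp_rw [hinv, ← integral_mul_const]
    rw [integral_integral_swap]
    · congr 1
      ext ω
      unfold mFT
      rw [← integral_const_mul]
      congr 1
      ext x
      have : Complex.exp (-(2 * (π : ℂ) * Complex.I * ((⟪x, ξ - ω⟫ : ℝ) : ℂ))) =
        Complex.exp (2 * (π : ℂ) * Complex.I * ((⟪x, ω⟫ : ℝ) : ℂ)) *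
        Complex.exp (-(2 * (π : ℂ) * Complex.I * ((⟪x, ξ⟫ : ℝ) : ℂ))) := by
        rw [← Complex.exp_add, inner_sub_right]
        push_cast
        ring_nf
      rw [this]
      ring
    · have i0 : Integrable (fun q : Ed d × Ed d => (1 : ℂ) * η q.2) (μ.prod volume) :=
        (integrable_const (1 : ℂ)).mul_prod η.integrable
      refine i0.mono ?_ ?_
      · apply Continuous.aestronglyMeasurable
        have := η.continuous
        simp only [Function.uncurry_def]
        fun_prop
      · filter_upwards with q
        simp [Function.uncurry_def, norm_exp_I, norm_exp_neg_I]
  rw [e]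
  have : (C₁ * ∫ ω, ‖η ω‖ * (1 + ‖ω‖) ^ k) * (1 + ‖ξ‖) ^ (-a) =
      ∫ ω, (C₁ * (1 + ‖ξ‖) ^ (-a)) * (‖η ω‖ * (1 + ‖ω‖) ^ k) := by
    rw [integral_const_mul]; ring
  rw [this]
  apply norm_integral_le_of_norm_le (hi.const_mul _)
  filter_upwards with ω
  rw [norm_mul]
  calc ‖η ω‖ * ‖mFT μ (ξ - ω)‖ ≤ ‖η ω‖ * (C₁ * ((1 + ‖ω‖) ^ k * (1 + ‖ξ‖) ^ (-a))) := by
        gcongr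
        refine (hdec _).trans ?_
        gcongr
        exact peetre ha hk ξ ω
    _ = _ := by ring

/-- radial derivative of `mFT` -/
def mFTd (μ : Measure (Ed d)) (s : ℝ) (ξ : Ed d) : ℂ :=
  ∫ x, (-(2 * (π : ℂ) * Complex.I * ((⟪x, ξ⟫ : ℝ) : ℂ))) *
    Complex.exp (-(2 * (π : ℂ) * Complex.I * ((⟪x, s • ξ⟫ : ℝ) : ℂ))) ∂μ

lemma mFT_hasDeriv (μ : Measure (Ed d)) [IsFiniteMeasure μ] {R : ℝ} (hR : ∀ᵐ y ∂μ, ‖y‖ ≤ R)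
    (s : ℝ) (ξ : Ed d) : HasDerivAt (fun s : ℝ => mFT μ (s • ξ)) (mFTd μ s ξ) s := by
  unfold mFT mFTd
  refine (hasDerivAt_integral_of_dominated_loc_of_deriv_le (s := univ) (𝕜 := ℝ)
    (F := fun s x => Complex.exp (-(2 * (π : ℂ) * Complex.I * ((⟪x, s • ξ⟫ : ℝ) : ℂ))))
    (F' := fun s x => (-(2 * (π : ℂ) * Complex.I * ((⟪x, ξ⟫ : ℝ) : ℂ))) *
    Complex.exp (-(2 * (π : ℂ) * Complex.I * ((⟪x, s • ξ⟫ : ℝ) : ℂ))))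
    (bound := fun _ => 2 * π * (R * ‖ξ‖)) Filter.univ_mem ?_ ?_ ?_ ?_ (integrable_const _) ?_).2
  · filter_upwards with s
    apply Continuous.aestronglyMeasurable
    fun_prop
  · refine (integrable_const (1 : ℝ)).mono' ?_ ?_
    · apply Continuous.aestronglyMeasurable
      fun_prop
    · filter_upwards with x
      rw [norm_exp_neg_I]
  · apply Continuous.aestronglyMeasurable
    fun_prop
  · filter_upwards [hR] with x hx s _
    rw [norm_mul, norm_exp_neg_I, mul_one, norm_neg, norm_mul, norm_mul, norm_mul,
      Complex.norm_I, mul_one, Complex.norm_real, Complex.norm_real]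
    simp only [Complex.norm_ofNat, Real.norm_of_nonneg Real.pi_pos.le]
    gcongr
    refine (norm_inner_le_norm _ _).trans ?_
    gcongr
  · filter_upwards with x s _
    have h1 : HasDerivAt (fun s : ℝ => ((⟪x, s • ξ⟫ : ℝ) : ℂ)) ((⟪x, ξ⟫ : ℝ) : ℂ) s := by
      have : HasDerivAt (fun s : ℝ => (⟪x, s • ξ⟫ : ℝ)) ((⟪x, ξ⟫ : ℝ)) s := by
        simp_rw [inner_smul_right]
        simpa using (hasDerivAt_id s).mul_const (⟪x, ξ⟫ : ℝ)
      exact this.ofReal_comp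
    have h2 := ((h1.const_mul (2 * (π : ℂ) * Complex.I)).neg).cexp
    exact h2.congr_deriv (mul_comm _ _)

lemma mFTd_measurable (μ : Measure (Ed d)) [IsFiniteMeasure μ] :
    StronglyMeasurable (fun q : ℝ × Ed d => mFTd μ q.1 q.2) := by
  unfold mFTd
  apply StronglyMeasurable.integral_prod_right
    (f := fun (q : ℝ × Ed d) (x : Ed d) => (-(2 * (π : ℂ) * Complex.I * ((⟪x, q.2⟫ : ℝ) : ℂ))) *
    Complex.exp (-(2 * (π : ℂ) * Complex.I * ((⟪x, q.1 • q.2⟫ : ℝ) : ℂ))))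
  apply Continuous.stronglyMeasurable
  simp only [Function.uncurry_def]
  fun_prop

lemma mFTd_decay (μ : Measure (Ed d)) [IsFiniteMeasure μ] {a C₁ R : ℝ} (ha : 0 < a) (hR0 : 0 < R)
    (hR : ∀ᵐ y ∂μ, ‖y‖ ≤ R)
    (hC₁ : 0 ≤ C₁) (hdec : ∀ ξ, ‖mFT μ ξ‖ ≤ C₁ * (1 + ‖ξ‖) ^ (-a)) :
    ∃ C₂ : ℝ, 0 ≤ C₂ ∧ ∀ (s : ℝ) (ξ : Ed d),
      ‖mFTd μ s ξ‖ ≤ C₂ * ‖ξ‖ * (1 + ‖s • ξ‖) ^ (-a) := by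
  let φ : ContDiffBump (0 : Ed d) := ⟨R, R + 1, hR0, by linarith⟩
  have hc : ∀ i : Fin d, HasCompactSupport (fun x : Ed d => (((x i * φ x) : ℝ) : ℂ)) := by
    intro i
    have := (φ.hasCompactSupport.mul_left (f := fun x : Ed d => x i))
    exact this.comp_left (g := fun r : ℝ => (r : ℂ)) (by simp)
  have hs : ∀ i : Fin d, ContDiff ℝ (⊤ : ℕ∞) (fun x : Ed d => (((x i * φ x) : ℝ) : ℂ)) := by
    intro i
    refine Complex.ofRealCLM.contDiff.comp ?_
    refine ContDiff.mul ?_ φ.contDiff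
    fun_prop
  choose K hK0 hK using fun i => twisted_decay μ ha hC₁ hdec ((hc i).toSchwartzMap (hs i))
  refine ⟨2 * π * ∑ i, K i, mul_nonneg (by positivity) (Finset.sum_nonneg fun i _ => hK0 i), ?_⟩
  intro s ξ
  have e : mFTd μ s ξ = ∑ i, (-(2 * (π : ℂ) * Complex.I)) * ((ξ i : ℝ) : ℂ) *
      ∫ x, ((hc i).toSchwartzMap (hs i)) x *
        Complex.exp (-(2 * (π : ℂ) * Complex.I * ((⟪x, s • ξ⟫ : ℝ) : ℂ))) ∂μ := by
    unfold mFTd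
    simp_rw [← integral_const_mul]
    rw [← integral_finsetSum]
    · apply integral_congr_ae
      filter_upwards [hR] with x hx
      have h1 : φ x = 1 := φ.one_of_mem_closedBall (by simpa using hx)
      have h2 : ∀ i, ((hc i).toSchwartzMap (hs i)) x = (((x i * φ x) : ℝ) : ℂ) := fun i => rfl
      simp_rw [h2, h1, mul_one]
      rw [PiLp.inner_apply]
      push_cast
      rw [Finset.mul_sum, ← Finset.sum_neg_distrib, Finset.sum_mul]
      apply Finset.sum_congr rfl
      intro i _
      simp
      ring
    · intro i _
      apply Integrable.const_mul
      obtain ⟨B, _, hB⟩ := schwartz_decay0 ((hc i).toSchwartzMap (hs i)) 0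
      refine (integrable_const B).mono' ?_ ?_
      · apply Continuous.aestronglyMeasurable
        have := ((hc i).toSchwartzMap (hs i)).continuous
        fun_prop
      · filter_upwards with x
        rw [norm_mul, norm_exp_neg_I, mul_one]
        simpa using hB x
  rw [e]
  refine (norm_sum_le _ _).trans ?_
  rw [Finset.mul_sum, Finset.sum_mul, Finset.sum_mul]
  apply Finset.sum_le_sum
  intro i _
  rw [norm_mul, norm_mul, norm_neg, norm_mul, norm_mul,
      Complex.norm_I, mul_one, Complex.norm_real, Complex.norm_real]
  simp only [Complex.norm_ofNat, Real.norm_of_nonneg Real.pi_pos.le]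
  calc 2 * π * ‖ξ i‖ * _ ≤ 2 * π * ‖ξ‖ * (K i * (1 + ‖s • ξ‖) ^ (-a)) := by
        gcongr
        · exact PiLp.norm_apply_le ξ i
        · exact hK i (s • ξ)
    _ = _ := by ring



/-! ### The `L²` maximal estimate -/

lemma sobolev_1d {u u' : ℝ → ℂ} (hu : ∀ s, 0 < s → HasDerivAt u (u' s) s)
    (hlim : Filter.Tendsto u Filter.atTop (nhds 0)) {κ : ℝ} (hκ : 0 < κ) {t : ℝ} (ht : 0 < t) :
    ‖u t‖ₑ ^ 2 ≤ ∫⁻ s in Ioi (0:ℝ), (ENNReal.ofReal (κ * s⁻¹) * ‖u s‖ₑ ^ 2 +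
      ENNReal.ofReal (s * κ⁻¹) * ‖u' s‖ₑ ^ 2) := by
  set g : ℝ → ℝ := fun s => ‖u s‖ ^ 2 with hg
  set g' : ℝ → ℝ := fun s => 2 * inner ℝ (u s) (u' s) with hg'
  have hder : ∀ s, 0 < s → HasDerivAt g (g' s) s := fun s hs => (hu s hs).norm_sq
  have hbound : ∀ s ∈ Ioi (0:ℝ), ‖g' s‖ₑ ≤ ENNReal.ofReal (κ * s⁻¹) * ‖u s‖ₑ ^ 2 +
      ENNReal.ofReal (s * κ⁻¹) * ‖u' s‖ₑ ^ 2 := by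
    intro s hs
    have hs0 : 0 < s := hs
    rw [← ofReal_norm, ← ofReal_norm, ← ofReal_norm, ← ENNReal.ofReal_pow (norm_nonneg _),
      ← ENNReal.ofReal_pow (norm_nonneg _), ← ENNReal.ofReal_mul (by positivity),
      ← ENNReal.ofReal_mul (by positivity), ← ENNReal.ofReal_add (by positivity) (by positivity)]
    apply ENNReal.ofReal_le_ofReal
    rw [hg', norm_mul, Real.norm_of_nonneg (zero_le_two)]
    have h1 : ‖(inner ℝ (u s) (u' s) : ℝ)‖ ≤ ‖u s‖ * ‖u' s‖ := norm_inner_le_norm _ _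
    have h2 : (κ * s⁻¹) * ‖u s‖ ^ 2 + (s * κ⁻¹) * ‖u' s‖ ^ 2 - 2 * (‖u s‖ * ‖u' s‖) =
        (κ * s⁻¹) * (‖u s‖ - s * κ⁻¹ * ‖u' s‖) ^ 2 := by
      field_simp
      ring
    have h3 : 0 ≤ (κ * s⁻¹) * (‖u s‖ - s * κ⁻¹ * ‖u' s‖) ^ 2 := by positivity
    linarith
  refine le_trans ?_ (setLIntegral_mono' measurableSet_Ioi hbound)
  by_cases hfin : ∫⁻ s in Ioi (0:ℝ), ‖g' s‖ₑ = ⊤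
  · rw [hfin]; exact le_top
  have hmeas : AEStronglyMeasurable g' (volume.restrict (Ioi (0:ℝ))) := by
    refine (measurable_deriv g).aestronglyMeasurable.congr ?_
    filter_upwards [ae_restrict_mem measurableSet_Ioi] with s hs
    exact (hder s hs).deriv
  have hIntg : IntegrableOn g' (Ioi (0:ℝ)) := ⟨hmeas, lt_top_iff_ne_top.2 hfin⟩
  have hsub : Ioi t ⊆ Ioi (0:ℝ) := fun s hs => ht.trans hs
  have hlim' : Filter.Tendsto g Filter.atTop (nhds 0) := by
    simpa [hg] using (hlim.norm.pow 2)
  have := integral_Ioi_of_hasDerivAt_of_tendsto' (a := t) (fun s hs => hder s (ht.trans_le hs))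
    (hIntg.mono_set hsub) hlim'
  have h4 : ‖g t‖ₑ ≤ ∫⁻ s in Ioi t, ‖g' s‖ₑ := by
    have h5 := enorm_integral_le_lintegral_enorm (μ := volume.restrict (Ioi t)) g'
    rw [this, zero_sub, enorm_neg] at h5
    exact h5
  refine le_trans (le_of_eq ?_) (h4.trans (lintegral_mono_set hsub))
  simp [hg, enorm_pow]

lemma lintegral_inv_interval {c : ℝ} (hc : 0 ≤ c) :
    ∫⁻ s in Ioi (0:ℝ), {s : ℝ | s * c ∈ Ioo (1/2 : ℝ) 2}.indicator
      (fun s => ENNReal.ofReal s⁻¹) s ≤ 4 := by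
  rcases hc.eq_or_lt with rfl | hc
  · simp
  have hset : {s : ℝ | s * c ∈ Ioo (1/2 : ℝ) 2} = Ioo (1 / 2 / c) (2 / c) := by
    ext s
    simp only [mem_ofPred_eq, mem_Ioo]
    rw [div_lt_iff₀ hc, lt_div_iff₀ hc]
  rw [hset]
  refine (setLIntegral_le_lintegral _ _).trans ?_
  rw [lintegral_indicator measurableSet_Ioo]
  calc ∫⁻ s in Ioo (1 / 2 / c) (2 / c), ENNReal.ofReal s⁻¹
      ≤ ∫⁻ s in Ioo (1 / 2 / c) (2 / c), ENNReal.ofReal (2 * c) := by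
        apply setLIntegral_mono' measurableSet_Ioo
        intro s hs
        apply ENNReal.ofReal_le_ofReal
        have h0 : 0 < 1 / 2 / c := by positivity
        calc s⁻¹ ≤ (1 / 2 / c)⁻¹ := by
              apply inv_anti₀ h0 hs.1.le
          _ = 2 * c := by field_simp
    _ = ENNReal.ofReal 3 := by
        rw [lintegral_const, Measure.restrict_apply MeasurableSet.univ, univ_inter, Real.volume_Ioo,
          ← ENNReal.ofReal_mul (by positivity)]
        congr 1
        field_simp
        norm_num
    _ ≤ 4 := by
        rw [← ENNReal.ofReal_ofNat 4]
        exact ENNReal.ofReal_le_ofReal (by norm_num)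

/-- the multiplier with radial scaling made explicit -/
def mS (μ : Measure (Ed d)) (β : ℝ → ℝ) (j : ℕ) (s : ℝ) (ξ : Ed d) : ℂ :=
  ((β (s * ((2:ℝ) ^ (-(j:ℤ)) * ‖ξ‖)) : ℝ) : ℂ) * mFT μ (s • ξ)

/-- its radial derivative -/
def mSd (μ : Measure (Ed d)) (β : ℝ → ℝ) (j : ℕ) (s : ℝ) (ξ : Ed d) : ℂ :=
  ((deriv β (s * ((2:ℝ) ^ (-(j:ℤ)) * ‖ξ‖)) * ((2:ℝ) ^ (-(j:ℤ)) * ‖ξ‖) : ℝ) : ℂ) * mFT μ (s • ξ) +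
  ((β (s * ((2:ℝ) ^ (-(j:ℤ)) * ‖ξ‖)) : ℝ) : ℂ) * mFTd μ s ξ

lemma mj_eq_mS (μ : Measure (Ed d)) (β : ℝ → ℝ) (j : ℕ) {s : ℝ} (hs : 0 < s) (ξ : Ed d) :
    mj μ β j (s • ξ) = mS μ β j s ξ := by
  unfold mj mS
  rw [norm_smul, Real.norm_of_nonneg hs.le]
  ring_nf

lemma mS_hasDeriv (μ : Measure (Ed d)) [IsFiniteMeasure μ] {R : ℝ} (hR : ∀ᵐ y ∂μ, ‖y‖ ≤ R)
    {β : ℝ → ℝ} (hβ : Differentiable ℝ β) (j : ℕ) (s : ℝ) (ξ : Ed d) :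
    HasDerivAt (fun s => mS μ β j s ξ) (mSd μ β j s ξ) s := by
  unfold mS mSd
  have h1 : HasDerivAt (fun s : ℝ => s * ((2:ℝ) ^ (-(j:ℤ)) * ‖ξ‖)) ((2:ℝ) ^ (-(j:ℤ)) * ‖ξ‖) s := by
    simpa using (hasDerivAt_id s).mul_const ((2:ℝ) ^ (-(j:ℤ)) * ‖ξ‖)
  have h2 := (hβ (s * ((2:ℝ) ^ (-(j:ℤ)) * ‖ξ‖))).hasDerivAt.comp s h1
  exact h2.ofReal_comp.mul (mFT_hasDeriv μ hR s ξ)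

lemma deriv_zero_of_supp {β : ℝ → ℝ} (hβsupp : Function.support β ⊆ Ioo (1/2 : ℝ) 2)
    (hβ : ContDiff ℝ (⊤ : ℕ∞) β) {r : ℝ}
    (hr : r ∉ Ioo (1/2 : ℝ) 2) : deriv β r = 0 := by
  have hc : Continuous (deriv β) := hβ.continuous_deriv (by norm_num)
  have h1 : Function.support (deriv β) ⊆ Icc (1/2 : ℝ) 2 := by
    refine (support_deriv_subset).trans ?_
    refine closure_minimal (hβsupp.trans Ioo_subset_Icc_self) isClosed_Icc
  by_contra h
  have hopen : IsOpen (Function.support (deriv β)) := hc.isOpen_support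
  have : Function.support (deriv β) ⊆ interior (Icc (1/2 : ℝ) 2) := interior_maximal h1 hopen
  rw [interior_Icc] at this
  exact hr (this h)

lemma mS_bound (μ : Measure (Ed d)) [IsFiniteMeasure μ]
    (hcomp : ∃ R : ℝ, 0 < R ∧ ∀ᵐ y ∂μ, ‖y‖ ≤ R) {a C : ℝ} (ha : 0 < a)
    (hdecay : ∀ ξ : Ed d, ξ ≠ 0 → ‖mFT μ ξ‖ ≤ C * ‖ξ‖ ^ (-a))
    {β : ℝ → ℝ} (hβsm : ContDiff ℝ (⊤ : ℕ∞) β)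
    (hβsupp : Function.support β ⊆ Ioo (1/2 : ℝ) 2) :
    ∃ M : ℝ, 0 ≤ M ∧ ∀ (j : ℕ) (s : ℝ) (ξ : Ed d), 0 < s →
      (s * ((2:ℝ) ^ (-(j:ℤ)) * ‖ξ‖) ∉ Ioo (1/2 : ℝ) 2 → mS μ β j s ξ = 0 ∧ mSd μ β j s ξ = 0) ∧
      ‖mS μ β j s ξ‖ ≤ M * 2 ^ (-a * (j:ℝ)) ∧
      ‖mSd μ β j s ξ‖ ≤ M * 2 ^ (-a * (j:ℝ)) * (2 ^ j * s⁻¹) := by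
  obtain ⟨R, hR0, hR⟩ := hcomp
  obtain ⟨C₁, hC₁, h1⟩ := mFT_decay μ ha hdecay
  obtain ⟨C₂, hC₂, h2⟩ := mFTd_decay μ ha hR0 hR hC₁ h1
  have hcs : HasCompactSupport β := HasCompactSupport.of_support_subset_isCompact isCompact_Icc
    (hβsupp.trans Ioo_subset_Icc_self)
  obtain ⟨B, hB⟩ := hcs.exists_bound_of_continuous hβsm.continuous
  obtain ⟨B', hB'⟩ := hcs.deriv.exists_bound_of_continuous (hβsm.continuous_deriv (by norm_num))
  have hB0 : 0 ≤ B := (norm_nonneg _).trans (hB 0)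
  have hB'0 : 0 ≤ B' := (norm_nonneg _).trans (hB' 0)
  refine ⟨2 ^ a * (B * C₁ + 2 * (B' * C₁ + B * C₂)), by positivity, ?_⟩
  intro j s ξ hs
  set b := (2:ℝ) ^ (-(j:ℤ)) with hb
  have hb0 : 0 < b := by positivity
  have hbj : b = (2 ^ j)⁻¹ := by rw [hb, zpow_neg, zpow_natCast]
  have hb1 : b ≤ 1 := by
    rw [hbj]
    exact inv_le_one_of_one_le₀ (one_le_pow₀ (by norm_num))
  have hzero : s * (b * ‖ξ‖) ∉ Ioo (1/2 : ℝ) 2 → mS μ β j s ξ = 0 ∧ mSd μ β j s ξ = 0 := by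
    intro h
    unfold mS mSd
    rw [← hb, beta_zero hβsupp h, deriv_zero_of_supp hβsupp hβsm h]
    simp
  refine ⟨hzero, ?_⟩
  by_cases hmem : s * (b * ‖ξ‖) ∈ Ioo (1/2 : ℝ) 2
  swap
  · obtain ⟨z1, z2⟩ := hzero hmem
    rw [z1, z2]
    simp only [norm_zero]
    constructor <;> positivity
  have hsξ : ‖s • ξ‖ = s * ‖ξ‖ := by rw [norm_smul, Real.norm_of_nonneg hs.le]
  have hlow : 2 ^ j / 2 ≤ 1 + ‖s • ξ‖ := by
    rw [hsξ]
    have := hmem.1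
    rw [hbj] at this
    have h3 : (2:ℝ) ^ j * (s * ((2 ^ j)⁻¹ * ‖ξ‖)) = s * ‖ξ‖ := by field_simp
    have h4 : (2:ℝ) ^ j * (1 / 2) ≤ (2:ℝ) ^ j * (s * ((2 ^ j)⁻¹ * ‖ξ‖)) := by gcongr
    rw [h3] at h4
    linarith
  have hup : ‖ξ‖ ≤ 2 * (2 ^ j * s⁻¹) := by
    have := hmem.2
    rw [hbj] at this
    have h3 : ‖ξ‖ = (2 ^ j * s⁻¹) * (s * ((2 ^ j)⁻¹ * ‖ξ‖)) := by field_simp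
    rw [h3, mul_comm 2]
    gcongr
  have hdec : (1 + ‖s • ξ‖) ^ (-a) ≤ 2 ^ a * 2 ^ (-a * (j:ℝ)) := by
    calc (1 + ‖s • ξ‖) ^ (-a) ≤ ((2:ℝ) ^ j / 2) ^ (-a) :=
          Real.rpow_le_rpow_of_nonpos (by positivity) hlow (by linarith)
      _ = _ := by
          rw [Real.div_rpow (by positivity) (by norm_num), ← Real.rpow_natCast, ← Real.rpow_mul
            (by norm_num), div_eq_mul_inv, ← Real.rpow_neg (by norm_num), neg_neg, mul_comm (j:ℝ)]
          ring
  have hX : ‖mFT μ (s • ξ)‖ ≤ C₁ * (2 ^ a * 2 ^ (-a * (j:ℝ))) := (h1 _).trans (by gcongr)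
  have hY : ‖mFTd μ s ξ‖ ≤ C₂ * (2 * (2 ^ j * s⁻¹)) * (2 ^ a * 2 ^ (-a * (j:ℝ))) :=
    (h2 s ξ).trans (by gcongr)
  have hZ : b * ‖ξ‖ ≤ 2 * (2 ^ j * s⁻¹) := by
    calc b * ‖ξ‖ ≤ 1 * ‖ξ‖ := by gcongr
      _ ≤ _ := by rw [one_mul]; exact hup
  constructor
  · unfold mS
    rw [norm_mul, Complex.norm_real]
    calc _ ≤ B * (C₁ * (2 ^ a * 2 ^ (-a * (j:ℝ)))) := by gcongr; exact hB _
      _ = (2 ^ a * (B * C₁)) * 2 ^ (-a * (j:ℝ)) := by ring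
      _ ≤ _ := by
        gcongr
        have : 0 ≤ 2 * (B' * C₁ + B * C₂) := by positivity
        linarith
  · unfold mSd
    refine (norm_add_le _ _).trans ?_
    rw [norm_mul, norm_mul, Complex.norm_real, Complex.norm_real, norm_mul,
      Real.norm_of_nonneg (by positivity : 0 ≤ b * ‖ξ‖)]
    calc _ ≤ B' * (2 * (2 ^ j * s⁻¹)) * (C₁ * (2 ^ a * 2 ^ (-a * (j:ℝ)))) +
          B * (C₂ * (2 * (2 ^ j * s⁻¹)) * (2 ^ a * 2 ^ (-a * (j:ℝ)))) := by
          gcongr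
          · exact hB' _
          · exact hB _
      _ = (2 ^ a * (2 * (B' * C₁ + B * C₂))) * 2 ^ (-a * (j:ℝ)) * (2 ^ j * s⁻¹) := by ring
      _ ≤ _ := by
        gcongr
        have : 0 ≤ B * C₁ := by positivity
        linarith



lemma bdd_supp_integrable {G : Ed d → ℂ} (hG : AEStronglyMeasurable G) {B r : ℝ}
    (hB : ∀ ξ, ‖G ξ‖ ≤ B) (hs : ∀ ξ ∉ closedBall (0 : Ed d) r, G ξ = 0) :
    Integrable G ∧ MemLp G 2 := by
  have hB0 : 0 ≤ B := (norm_nonneg _).trans (hB 0)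
  have key : ∀ ξ, ‖G ξ‖ ≤ ‖(closedBall (0 : Ed d) r).indicator (fun _ => B) ξ‖ := by
    intro ξ
    by_cases h : ξ ∈ closedBall (0 : Ed d) r
    · rw [indicator_of_mem h, Real.norm_of_nonneg hB0]; exact hB ξ
    · rw [hs ξ h]; simp
  have hfin : volume (closedBall (0 : Ed d) r) ≠ ⊤ := measure_closedBall_lt_top.ne
  have m : ∀ p : ℝ≥0∞, MemLp G p := fun p =>
    (memLp_indicator_const p measurableSet_closedBall B (Or.inr hfin)).mono hG
      (Filter.Eventually.of_forall key)
  exact ⟨memLp_one_iff_integrable.1 (m 1), m 2⟩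

lemma mS_meas (μ : Measure (Ed d)) [IsFiniteMeasure μ] {β : ℝ → ℝ} (hβ : Continuous β) (j : ℕ) :
    StronglyMeasurable (fun q : ℝ × Ed d => mS μ β j q.1 q.2) := by
  apply Continuous.stronglyMeasurable
  unfold mS
  have := mFT_continuous μ
  fun_prop

lemma mSd_meas (μ : Measure (Ed d)) [IsFiniteMeasure μ] {β : ℝ → ℝ} (hβ : Continuous β)
    (hβ' : Continuous (deriv β)) (j : ℕ) :
    StronglyMeasurable (fun q : ℝ × Ed d => mSd μ β j q.1 q.2) := by
  unfold mSd
  have := mFT_continuous μ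
  refine StronglyMeasurable.add ?_ (StronglyMeasurable.mul ?_ (mFTd_measurable μ))
  · apply Continuous.stronglyMeasurable
    fun_prop
  · apply Continuous.stronglyMeasurable
    fun_prop

lemma fourierInv_joint_meas {F : ℝ → Ed d → ℂ}
    (hF : StronglyMeasurable (fun q : ℝ × Ed d => F q.1 q.2)) :
    StronglyMeasurable (fun q : Ed d × ℝ => 𝓕⁻ (F q.2) q.1) := by
  simp_rw [Real.fourierInv_eq']
  apply StronglyMeasurable.integral_prod_right
    (f := fun (q : Ed d × ℝ) (v : Ed d) =>
      Complex.exp (((2 * π * ⟪v, q.1⟫ : ℝ) : ℂ) * Complex.I) • F q.2 v)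
  simp only [Function.uncurry_def]
  refine StronglyMeasurable.smul (f := fun x : (Ed d × ℝ) × Ed d =>
    Complex.exp (((2 * π * ⟪x.2, x.1.1⟫ : ℝ) : ℂ) * Complex.I)) ?_ ?_
  · apply Continuous.stronglyMeasurable
    fun_prop
  · exact hF.comp_measurable (g := fun x : (Ed d × ℝ) × Ed d => (x.1.2, x.2)) (by fun_prop)

lemma norm_fourierInv_le (G : Ed d → ℂ) (x : Ed d) : ‖𝓕⁻ G x‖ ≤ ∫ ξ, ‖G ξ‖ := by
  rw [Real.fourierInv_eq_fourier_neg]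
  exact fourier_norm_le G (-x)

set_option maxHeartbeats 1000000 in
lemma L2_star (hd : 1 ≤ d) (μ : Measure (Ed d)) [IsFiniteMeasure μ]
    (hcomp : ∃ R : ℝ, 0 < R ∧ ∀ᵐ y ∂μ, ‖y‖ ≤ R) {a C : ℝ} (ha : 0 < a)
    (hdecay : ∀ ξ : Ed d, ξ ≠ 0 → ‖mFT μ ξ‖ ≤ C * ‖ξ‖ ^ (-a))
    {β : ℝ → ℝ} (hβsm : ContDiff ℝ (⊤ : ℕ∞) β)
    (hβsupp : Function.support β ⊆ Ioo (1/2 : ℝ) 2) :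
    ∃ M : ℝ, 0 ≤ M ∧ ∀ (j : ℕ) (h : Ed d → ℂ), Integrable h → MemLp h 2 →
      ∫⁻ x, TjStar μ β j h x ^ 2 ≤
        ENNReal.ofReal (M * 2 ^ ((1 - 2 * a) * (j:ℝ))) * ∫⁻ x, ‖h x‖ₑ ^ 2 := by
  obtain ⟨M, hM0, hM⟩ := mS_bound μ hcomp ha hdecay hβsm hβsupp
  obtain ⟨R, hR0, hR⟩ := hcomp
  refine ⟨M ^ 2 * 8, by positivity, ?_⟩
  intro j h hh hh2
  have hβc := hβsm.continuous
  have hβ'c : Continuous (deriv β) := hβsm.continuous_deriv (by norm_num)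
  have hβd : Differentiable ℝ β := hβsm.differentiable (by norm_num)
  set b := (2:ℝ) ^ (-(j:ℤ)) with hb
  have hb0 : 0 < b := by positivity
  set N := ∫ x, ‖h x‖ with hN
  have hN0 : 0 ≤ N := integral_nonneg fun x => norm_nonneg _
  set A := M * 2 ^ (-a * (j:ℝ)) with hA
  have hA0 : 0 ≤ A := by positivity
  set F : ℝ → Ed d → ℂ := fun s ξ => mS μ β j s ξ * 𝓕 h ξ with hF
  set F' : ℝ → Ed d → ℂ := fun s ξ => mSd μ β j s ξ * 𝓕 h ξ with hF'
  have hFcont := fourier_cont hh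
  have hFm : StronglyMeasurable (fun q : ℝ × Ed d => F q.1 q.2) :=
    (mS_meas μ hβc j).mul (hFcont.comp continuous_snd).stronglyMeasurable
  have hF'm : StronglyMeasurable (fun q : ℝ × Ed d => F' q.1 q.2) :=
    (mSd_meas μ hβc hβ'c j).mul (hFcont.comp continuous_snd).stronglyMeasurable
  have hFs : ∀ s, StronglyMeasurable (F s) := fun s =>
    hFm.comp_measurable (g := fun ξ => (s, ξ)) (by fun_prop)
  have hF's : ∀ s, StronglyMeasurable (F' s) := fun s =>
    hF'm.comp_measurable (g := fun ξ => (s, ξ)) (by fun_prop)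
  have hFb : ∀ s, 0 < s → ∀ ξ, ‖F s ξ‖ ≤ A * N := by
    intro s hs ξ
    rw [hF, norm_mul]
    gcongr
    · exact (hM j s ξ hs).2.1
    · exact fourier_norm_le h ξ
  have hF'b : ∀ s, 0 < s → ∀ ξ, ‖F' s ξ‖ ≤ A * (2 ^ j * s⁻¹) * N := by
    intro s hs ξ
    rw [hF', norm_mul]
    gcongr
    · exact (hM j s ξ hs).2.2
    · exact fourier_norm_le h ξ
  have hnot : ∀ s, 0 < s → ∀ ξ ∉ closedBall (0 : Ed d) (2 / (s * b)),
      s * (b * ‖ξ‖) ∉ Ioo (1/2 : ℝ) 2 := by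
    intro s hs ξ hξ hc
    apply hξ
    rw [mem_closedBall_zero_iff, le_div_iff₀ (by positivity)]
    have := hc.2
    linarith
  have hFsupp : ∀ s, 0 < s → ∀ ξ ∉ closedBall (0 : Ed d) (2 / (s * b)), F s ξ = 0 := by
    intro s hs ξ hξ
    rw [hF]
    simp only [((hM j s ξ hs).1 (hnot s hs ξ hξ)).1, zero_mul]
  have hF'supp : ∀ s, 0 < s → ∀ ξ ∉ closedBall (0 : Ed d) (2 / (s * b)), F' s ξ = 0 := by
    intro s hs ξ hξ
    rw [hF']
    simp only [((hM j s ξ hs).1 (hnot s hs ξ hξ)).2, zero_mul]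
  have hFi := fun s hs => bdd_supp_integrable (hFs s).aestronglyMeasurable (hFb s hs) (hFsupp s hs)
  have hF'i := fun s hs =>
    bdd_supp_integrable (hF's s).aestronglyMeasurable (hF'b s hs) (hF'supp s hs)
  have hTj : ∀ s, 0 < s → Tj μ β j s h = 𝓕⁻ (F s) := by
    intro s hs
    rw [Tj_eq_fourierInv]
    congr 1
    ext ξ
    rw [mj_eq_mS μ β j hs]
  -- derivative
  have hder : ∀ x s, 0 < s → HasDerivAt (fun s => 𝓕⁻ (F s) x) (𝓕⁻ (F' s) x) s := by
    intro x s₀ hs₀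
    simp_rw [Real.fourierInv_eq']
    have hs2 : 0 < s₀ / 2 := by positivity
    refine (hasDerivAt_integral_of_dominated_loc_of_deriv_le (s := Ioi (s₀ / 2)) (𝕜 := ℝ)
      (F := fun s ξ => Complex.exp (((2 * π * ⟪ξ, x⟫ : ℝ) : ℂ) * Complex.I) • F s ξ)
      (F' := fun s ξ => Complex.exp (((2 * π * ⟪ξ, x⟫ : ℝ) : ℂ) * Complex.I) • F' s ξ)
      (bound := (closedBall (0 : Ed d) (2 / (s₀ / 2 * b))).indicator
        (fun _ => A * (2 ^ j * (s₀ / 2)⁻¹) * N)) (Ioi_mem_nhds (by linarith)) ?_ ?_ ?_ ?_ ?_ ?_).2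
    · filter_upwards with s
      refine AEStronglyMeasurable.smul (f := fun ξ =>
        Complex.exp (((2 * π * ⟪ξ, x⟫ : ℝ) : ℂ) * Complex.I)) ?_ (hFs s).aestronglyMeasurable
      apply Continuous.aestronglyMeasurable
      fun_prop
    · refine ((hFi s₀ hs₀).1).bdd_mul (c := 1) ?_ ?_
      · apply Continuous.aestronglyMeasurable
        fun_prop
      · filter_upwards with ξ
        rw [Complex.norm_exp_ofReal_mul_I]
    · refine AEStronglyMeasurable.smul (f := fun ξ =>
        Complex.exp (((2 * π * ⟪ξ, x⟫ : ℝ) : ℂ) * Complex.I)) ?_ (hF's s₀).aestronglyMeasurable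
      apply Continuous.aestronglyMeasurable
      fun_prop
    · filter_upwards with ξ s hs
      have hs' : s₀ / 2 < s := hs
      have hs0 : 0 < s := hs2.trans hs'
      rw [norm_smul, Complex.norm_exp_ofReal_mul_I, one_mul]
      by_cases hξ : ξ ∈ closedBall (0 : Ed d) (2 / (s₀ / 2 * b))
      · rw [indicator_of_mem hξ]
        refine (hF'b s hs0 ξ).trans ?_
        gcongr
      · rw [indicator_of_notMem hξ, hF'supp s hs0 ξ, norm_zero]
        intro hc
        apply hξ
        refine closedBall_subset_closedBall ?_ hc
        gcongr
    · rw [integrable_indicator_iff measurableSet_closedBall]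
      exact integrableOn_const measure_closedBall_lt_top.ne
    · filter_upwards with ξ s hs
      have := (mS_hasDeriv μ hR hβd j s ξ).mul_const (𝓕 h ξ)
      exact this.const_smul (Complex.exp (((2 * π * ⟪ξ, x⟫ : ℝ) : ℂ) * Complex.I))
  -- decay at infinity
  have hlim : ∀ x, Filter.Tendsto (fun s => 𝓕⁻ (F s) x) Filter.atTop (nhds 0) := by
    intro x
    have hv : Filter.Tendsto (fun s : ℝ => A * N * ((2 / (s * b)) ^ d *
        volume.real (ball (0 : Ed d) 1))) Filter.atTop (nhds 0) := by
      have h1 : Filter.Tendsto (fun s : ℝ => 2 / (s * b)) Filter.atTop (nhds 0) :=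
        Filter.Tendsto.const_div_atTop (Filter.Tendsto.atTop_mul_const hb0 Filter.tendsto_id) 2
      have h2 := ((h1.pow d).mul_const (volume.real (ball (0 : Ed d) 1))).const_mul (A * N)
      rw [zero_pow (by omega), zero_mul, mul_zero] at h2
      exact h2
    refine squeeze_zero_norm' ?_ hv
    filter_upwards [Filter.eventually_gt_atTop 0] with s hs
    refine (norm_fourierInv_le _ _).trans ?_
    have hvol : volume.real (closedBall (0 : Ed d) (2 / (s * b))) =
        (2 / (s * b)) ^ d * volume.real (ball (0 : Ed d) 1) := by
      have := Measure.addHaar_real_closedBall (volume : Measure (Ed d)) 0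
        (r := 2 / (s * b)) (by positivity)
      rw [this, finrank_euclideanSpace_fin]
    rw [← hvol, ← setIntegral_eq_integral_of_forall_compl_eq_zero
      (s := closedBall (0 : Ed d) (2 / (s * b)))]
    · have := norm_setIntegral_le_of_norm_le_const (f := fun ξ => ‖F s ξ‖)
        (measure_closedBall_lt_top (μ := (volume : Measure (Ed d))) (x := 0) (r := 2 / (s * b)))
        (fun ξ _ => by rw [norm_norm]; exact hFb s hs ξ)
      exact (le_abs_self _).trans this
    · intro ξ hξ
      rw [hFsupp s hs ξ hξ, norm_zero]
  set κ : ℝ := 2 ^ j with hκ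
  have hκ0 : 0 < κ := by positivity
  -- pointwise
  have pt : ∀ x, TjStar μ β j h x ^ 2 ≤ ∫⁻ s in Ioi (0:ℝ),
      (ENNReal.ofReal (κ * s⁻¹) * ‖𝓕⁻ (F s) x‖ₑ ^ 2 +
      ENNReal.ofReal (s * κ⁻¹) * ‖𝓕⁻ (F' s) x‖ₑ ^ 2) := by
    intro x
    have : ∀ t : {t : ℝ // 0 < t}, ‖Tj μ β j t h x‖ₑ ^ 2 ≤ ∫⁻ s in Ioi (0:ℝ),
      (ENNReal.ofReal (κ * s⁻¹) * ‖𝓕⁻ (F s) x‖ₑ ^ 2 +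
      ENNReal.ofReal (s * κ⁻¹) * ‖𝓕⁻ (F' s) x‖ₑ ^ 2) := by
      intro t
      rw [hTj t t.2]
      exact sobolev_1d (hder x) (hlim x) hκ0 t.2
    unfold TjStar
    have e2 : ∀ y z : ℝ≥0∞, y ^ 2 ≤ z ↔ y ≤ z ^ ((2 : ℝ)⁻¹) := by
      intro y z
      rw [ENNReal.le_rpow_inv_iff two_pos]
      simp
    rw [e2]
    refine iSup_le fun t => ?_
    rw [← e2]
    exact this t
  have hUm := fourierInv_joint_meas hFm
  have hU'm := fourierInv_joint_meas hF'm
  calc ∫⁻ x, TjStar μ β j h x ^ 2 ≤ ∫⁻ x, ∫⁻ s in Ioi (0:ℝ),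
      (ENNReal.ofReal (κ * s⁻¹) * ‖𝓕⁻ (F s) x‖ₑ ^ 2 +
      ENNReal.ofReal (s * κ⁻¹) * ‖𝓕⁻ (F' s) x‖ₑ ^ 2) := lintegral_mono pt
    _ = ∫⁻ s in Ioi (0:ℝ), ∫⁻ x, (ENNReal.ofReal (κ * s⁻¹) * ‖𝓕⁻ (F s) x‖ₑ ^ 2 +
      ENNReal.ofReal (s * κ⁻¹) * ‖𝓕⁻ (F' s) x‖ₑ ^ 2) := by
        rw [lintegral_lintegral_swap]
        apply Measurable.aemeasurable
        simp only [Function.uncurry_def]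
        have m1 := hUm.measurable
        have m2 := hU'm.measurable
        refine Measurable.add (Measurable.mul ?_ (m1.enorm.pow_const 2))
          (Measurable.mul ?_ (m2.enorm.pow_const 2))
        · apply ENNReal.measurable_ofReal.comp
          fun_prop
        · apply ENNReal.measurable_ofReal.comp
          fun_prop
    _ ≤ ∫⁻ s in Ioi (0:ℝ), ∫⁻ ξ, ENNReal.ofReal (2 * A ^ 2 * κ) *
          ({s : ℝ | s * (b * ‖ξ‖) ∈ Ioo (1/2 : ℝ) 2}.indicator
          (fun s => ENNReal.ofReal s⁻¹) s * ‖𝓕 h ξ‖ₑ ^ 2) := by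
        apply setLIntegral_mono' measurableSet_Ioi
        intro s hs
        have hs0 : 0 < s := hs
        have m1 : Measurable fun x => 𝓕⁻ (F s) x :=
          (hUm.comp_measurable (g := fun x => (x, s)) (by fun_prop)).measurable
        rw [lintegral_add_left ((m1.enorm.pow_const 2).const_mul _),
          lintegral_const_mul' _ _ ENNReal.ofReal_ne_top,
          lintegral_const_mul' _ _ ENNReal.ofReal_ne_top,
          lintegral_fourierInv_sq (hFi s hs0).1 (hFi s hs0).2,
          lintegral_fourierInv_sq (hF'i s hs0).1 (hF'i s hs0).2,
          ← lintegral_const_mul' _ _ ENNReal.ofReal_ne_top,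
          ← lintegral_const_mul' _ _ ENNReal.ofReal_ne_top,
          ← lintegral_add_left (((hFs s).measurable.enorm.pow_const 2).const_mul _)]
        apply lintegral_mono
        intro ξ
        simp only
        by_cases hmem : s * (b * ‖ξ‖) ∈ Ioo (1/2 : ℝ) 2
        · rw [indicator_of_mem (by exact hmem)]
          simp only [hF, hF', enorm_mul, mul_pow]
          rw [← mul_assoc, ← mul_assoc, ← mul_assoc, ← add_mul]
          gcongr
          rw [← ofReal_norm, ← ofReal_norm, ← ENNReal.ofReal_pow (norm_nonneg _),
            ← ENNReal.ofReal_pow (norm_nonneg _), ← ENNReal.ofReal_mul (by positivity),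
            ← ENNReal.ofReal_mul (by positivity), ← ENNReal.ofReal_mul (by positivity),
            ← ENNReal.ofReal_add (by positivity) (by positivity)]
          apply ENNReal.ofReal_le_ofReal
          have b1 := (hM j s ξ hs0).2.1
          have b2 := (hM j s ξ hs0).2.2
          calc κ * s⁻¹ * ‖mS μ β j s ξ‖ ^ 2 + s * κ⁻¹ * ‖mSd μ β j s ξ‖ ^ 2
              ≤ κ * s⁻¹ * A ^ 2 + s * κ⁻¹ * (A * (κ * s⁻¹)) ^ 2 := by gcongr
            _ = _ := by field_simp; ring
        · obtain ⟨z1, z2⟩ := (hM j s ξ hs0).1 hmem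
          simp only [hF, hF', z1, z2]
          simp
    _ = ∫⁻ ξ, ∫⁻ s in Ioi (0:ℝ), ENNReal.ofReal (2 * A ^ 2 * κ) *
          ({s : ℝ | s * (b * ‖ξ‖) ∈ Ioo (1/2 : ℝ) 2}.indicator
          (fun s => ENNReal.ofReal s⁻¹) s * ‖𝓕 h ξ‖ₑ ^ 2) := by
        rw [lintegral_lintegral_swap]
        apply Measurable.aemeasurable
        simp only [Function.uncurry_def]
        refine Measurable.const_mul (Measurable.mul ?_ ?_) _
        · have : Measurable ({q : ℝ × Ed d | q.1 * (b * ‖q.2‖) ∈ Ioo (1/2 : ℝ) 2}.indicator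
            (fun q : ℝ × Ed d => ENNReal.ofReal q.1⁻¹)) := by
            apply Measurable.indicator
            · fun_prop
            · exact measurableSet_Ioo.preimage
                (f := fun q : ℝ × Ed d => q.1 * (b * ‖q.2‖)) (by fun_prop)
          exact this
        · have := hFcont.measurable
          fun_prop
    _ ≤ ∫⁻ ξ, ENNReal.ofReal (2 * A ^ 2 * κ) * 4 * ‖𝓕 h ξ‖ₑ ^ 2 := by
        apply lintegral_mono
        intro ξ
        simp only
        rw [lintegral_const_mul' _ _ ENNReal.ofReal_ne_top, lintegral_mul_const' _ _ (by simp),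
          mul_assoc (ENNReal.ofReal _) 4]
        gcongr
        exact lintegral_inv_interval (by positivity)
    _ = _ := by
        rw [lintegral_const_mul' _ _ (by finiteness), lintegral_fourier_sq hh hh2]
        congr 1
        rw [← ENNReal.ofReal_ofNat 4, ← ENNReal.ofReal_mul (by positivity)]
        congr 1
        have : (2:ℝ) ^ ((1 - 2 * a) * (j:ℝ)) = (2 ^ (-a * (j:ℝ))) ^ 2 * 2 ^ j := by
          rw [← Real.rpow_natCast 2 j, ← Real.rpow_natCast _ 2, ← Real.rpow_mul (by norm_num),
            ← Real.rpow_add (by norm_num)]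
          congr 1
          push_cast
          ring
        rw [this, hA, hκ]
        ring



/-! ### Dyadic cubes and the Calderón–Zygmund decomposition -/

/-- index of the dyadic cube of generation `k` containing `x` -/
def cq (ε : ℝ) : ℕ → Ed d → (Fin d → ℤ)
  | 0, x => fun i => ⌊x i / ε⌋
  | k + 1, x => fun i => cq ε k x i / 2

lemma cq_nested (ε : ℝ) {k m : ℕ} (hkm : k ≤ m) {x y : Ed d} (h : cq ε k x = cq ε k y) :
    cq ε m x = cq ε m y := by
  induction m, hkm using Nat.le_induction with
  | base => exact h
  | succ m _ ih =>
    ext i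
    simp only [cq, ih]

lemma cq_iff {ε : ℝ} (hε : 0 < ε) (k : ℕ) (x : Ed d) (i : Fin d) (z : ℤ) :
    cq ε k x i = z ↔ (ε * 2 ^ k) * z ≤ x i ∧ x i < (ε * 2 ^ k) * (z + 1) := by
  induction k generalizing z with
  | zero =>
    simp only [cq, pow_zero, mul_one]
    rw [Int.floor_eq_iff, le_div_iff₀ hε, div_lt_iff₀ hε, mul_comm ε, mul_comm ε]
  | succ k ih =>
    have h1 : cq ε (k + 1) x i = z ↔ cq ε k x i = 2 * z ∨ cq ε k x i = 2 * z + 1 := by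
      simp only [cq]
      omega
    rw [h1, ih, ih]
    have hl : 0 < ε * 2 ^ k := by positivity
    rw [pow_succ]
    push_cast
    constructor
    · rintro (⟨a, b⟩ | ⟨a, b⟩)
      · constructor <;> nlinarith
      · constructor <;> nlinarith
    · rintro ⟨a, b⟩
      rcases lt_or_ge (x i) (ε * 2 ^ k * (2 * z + 1)) with h | h
      · left; constructor <;> nlinarith
      · right; constructor <;> nlinarith

/-- dyadic cubes -/
def cube (ε : ℝ) (i : ℕ × (Fin d → ℤ)) : Set (Ed d) := {x | cq ε i.1 x = i.2}

/-- side length -/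
def len (ε : ℝ) (i : ℕ × (Fin d → ℤ)) : ℝ := ε * 2 ^ i.1

lemma mem_cube_self (ε : ℝ) (k : ℕ) (x : Ed d) : x ∈ cube ε (k, cq ε k x) := rfl

lemma len_pos {ε : ℝ} (hε : 0 < ε) (i : ℕ × (Fin d → ℤ)) : 0 < len ε i := by
  unfold len; positivity

lemma cube_eq_pi {ε : ℝ} (hε : 0 < ε) (i : ℕ × (Fin d → ℤ)) :
    cube ε i = (WithLp.ofLp : Ed d → (Fin d → ℝ)) ⁻¹' (univ.pi fun l =>
      Ico (len ε i * i.2 l) (len ε i * (i.2 l + 1))) := by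
  ext x
  simp only [cube, mem_ofPred_eq, mem_preimage, mem_univ_pi, mem_Ico]
  rw [funext_iff]
  exact forall_congr' fun l => cq_iff hε i.1 x l (i.2 l)

lemma cube_measurable {ε : ℝ} (hε : 0 < ε) (i : ℕ × (Fin d → ℤ)) : MeasurableSet (cube ε i) := by
  rw [cube_eq_pi hε]
  exact (MeasurableSet.univ_pi fun l => measurableSet_Ico).preimage
    (PiLp.volume_preserving_ofLp (Fin d)).measurable

lemma cube_volume {ε : ℝ} (hε : 0 < ε) (i : ℕ × (Fin d → ℤ)) :
    volume (cube ε i) = ENNReal.ofReal (len ε i ^ d) := by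
  rw [cube_eq_pi hε, (PiLp.volume_preserving_ofLp (Fin d)).measure_preimage
    (MeasurableSet.univ_pi fun l => measurableSet_Ico).nullMeasurableSet, Real.volume_pi_Ico]
  have : ∀ l : Fin d, len ε i * (i.2 l + 1) - len ε i * i.2 l = len ε i := fun l => by ring
  simp_rw [this]
  rw [Finset.prod_const, Finset.card_univ, Fintype.card_fin, ENNReal.ofReal_pow (len_pos hε i).le]

lemma cube_volume_real {ε : ℝ} (hε : 0 < ε) (i : ℕ × (Fin d → ℤ)) :
    volume.real (cube ε i) = len ε i ^ d := by
  rw [Measure.real, cube_volume hε, ENNReal.toReal_ofReal (pow_nonneg (len_pos hε i).le _)]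

lemma norm_le_card {r : ℝ} (x : Ed d) (h : ∀ i, ‖x i‖ ≤ r) : ‖x‖ ≤ d * r := by
  have e : x = ∑ i, x i • EuclideanSpace.single i (1:ℝ) := by
    ext l
    simp [Finset.sum_apply, Pi.single_apply]
  rw [e]
  refine (norm_sum_le _ _).trans ?_
  refine (Finset.sum_le_card_nsmul _ _ r ?_).trans (by simp)
  intro i _
  rw [norm_smul]
  simpa using h i

lemma cube_dist {ε : ℝ} (hε : 0 < ε) (i : ℕ × (Fin d → ℤ)) {x y : Ed d} (hx : x ∈ cube ε i)
    (hy : y ∈ cube ε i) : ‖x - y‖ ≤ d * len ε i := by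
  apply norm_le_card
  intro l
  have h1 := (cq_iff hε i.1 x l (i.2 l)).1 (congrFun hx l)
  have h2 := (cq_iff hε i.1 y l (i.2 l)).1 (congrFun hy l)
  rw [Real.norm_eq_abs, abs_le]
  unfold len
  simp only [PiLp.sub_apply]
  constructor <;> nlinarith [h1.1, h1.2, h2.1, h2.2]

/-- average of `‖f‖` -/
def avgN (f : Ed d → ℂ) (ε : ℝ) (i : ℕ × (Fin d → ℤ)) : ℝ :=
  (len ε i ^ d)⁻¹ * ∫ x in cube ε i, ‖f x‖

/-- selected cubes at height `l` -/
def sel (f : Ed d → ℂ) (ε l : ℝ) (i : ℕ × (Fin d → ℤ)) : Prop :=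
  l < avgN f ε i ∧ ∀ x ∈ cube ε i, ∀ m, i.1 < m → avgN f ε (m, cq ε m x) ≤ l

lemma sel_of_gt {f : Ed d → ℂ} (hd : 1 ≤ d) (hf : Integrable f) {ε l : ℝ} (hε : 0 < ε) (hl : 0 < l)
    {x : Ed d} {k : ℕ} (h : l < avgN f ε (k, cq ε k x)) :
    ∃ m, sel f ε l (m, cq ε m x) := by
  have hlim : Filter.Tendsto (fun m : ℕ => ((ε * 2 ^ m) ^ d)⁻¹ * ∫ x, ‖f x‖) Filter.atTop
      (nhds 0) := by
    have h1 : Filter.Tendsto (fun m : ℕ => (ε * 2 ^ m : ℝ)) Filter.atTop Filter.atTop :=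
      Filter.Tendsto.const_mul_atTop hε (tendsto_pow_atTop_atTop_of_one_lt (by norm_num))
    have h2 := (Filter.tendsto_pow_atTop (α := ℝ) (n := d) (by omega)).comp h1
    simpa using h2.inv_tendsto_atTop.mul_const (∫ x, ‖f x‖)
  obtain ⟨m₀, hm₀⟩ := Filter.eventually_atTop.1 (hlim.eventually (gt_mem_nhds hl))
  have hup : ∀ m, m₀ ≤ m → ¬ l < avgN f ε (m, cq ε m x) := by
    intro m hm
    have := hm₀ m hm
    rw [not_lt]
    refine le_trans ?_ this.le
    unfold avgN len
    gcongr
    · filter_upwards with x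
      exact norm_nonneg _
    · exact hf.norm
    · exact Measure.restrict_le_self
  classical
  set P : ℕ → Prop := fun m => l < avgN f ε (m, cq ε m x) with hP
  have hk : k ≤ m₀ := by
    by_contra hc
    exact hup k (by omega) h
  refine ⟨Nat.findGreatest P m₀, Nat.findGreatest_spec (P := P) hk h, ?_⟩
  intro y hy m hm
  have e : cq ε m y = cq ε m x := cq_nested ε hm.le hy
  rw [e]
  by_contra hc
  rw [not_le] at hc
  have hmm : m ≤ m₀ := by
    by_contra hc'
    exact hup m (by omega) hc
  have := Nat.le_findGreatest (P := P) hmm hc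
  simp only at hm
  omega

lemma sel_compare {f : Ed d → ℂ} {ε l l' : ℝ} (hll : l ≤ l') {i i' : ℕ × (Fin d → ℤ)}
    (h : sel f ε l i) (h' : sel f ε l' i') {x : Ed d} (hx : x ∈ cube ε i) (hx' : x ∈ cube ε i') :
    cube ε i' ⊆ cube ε i := by
  have hi' : i' = (i'.1, cq ε i'.1 x) := by
    ext1
    · rfl
    · exact hx'.symm
  have hle : i'.1 ≤ i.1 := by
    by_contra hc
    have h1 := h.2 x hx i'.1 (by omega)
    have h2 := h'.1
    rw [hi'] at h2
    linarith
  intro y hy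
  have : cq ε i'.1 y = cq ε i'.1 x := hy.trans hx'.symm
  have h3 := cq_nested ε hle this
  exact h3.trans hx

lemma sel_disjoint {f : Ed d → ℂ} {ε l : ℝ} {i i' : ℕ × (Fin d → ℤ)}
    (h : sel f ε l i) (h' : sel f ε l i') (hne : i ≠ i') : Disjoint (cube ε i) (cube ε i') := by
  rw [Set.disjoint_left]
  intro x hx hx'
  apply hne
  have key : ∀ {i i' : ℕ × (Fin d → ℤ)}, sel f ε l i → sel f ε l i' → x ∈ cube ε i →
      x ∈ cube ε i' → i'.1 ≤ i.1 := by
    intro i i' h h' hx hx'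
    by_contra hc
    have h1 := h.2 x hx i'.1 (by omega)
    have h2 := h'.1
    have hi' : i' = (i'.1, cq ε i'.1 x) := by
      ext1
      · rfl
      · exact hx'.symm
    rw [hi'] at h2
    linarith
  have e := le_antisymm (key h' h hx' hx) (key h h' hx hx')
  have hz : i.2 = i'.2 := by
    have h1 : cq ε i.1 x = i.2 := hx
    have h2 : cq ε i'.1 x = i'.2 := hx'
    rw [← h1, ← h2, e]
  exact Prod.ext e hz

lemma sel_lower {f : Ed d → ℂ} {ε l : ℝ} (hε : 0 < ε) {i : ℕ × (Fin d → ℤ)} (h : sel f ε l i) :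
    l * len ε i ^ d ≤ ∫ x in cube ε i, ‖f x‖ := by
  have h1 := h.1.le
  unfold avgN at h1
  have := len_pos hε i
  rw [inv_mul_eq_div, le_div_iff₀ (by positivity)] at h1
  exact h1

lemma cube_nonempty {ε : ℝ} (hε : 0 < ε) (i : ℕ × (Fin d → ℤ)) : (cube ε i).Nonempty := by
  apply nonempty_of_measure_ne_zero (μ := volume)
  rw [cube_volume hε]
  have := len_pos hε i
  have : 0 < len ε i ^ d := by positivity
  simpa using this

lemma sel_upper {f : Ed d → ℂ} (hf : Integrable f) {ε l : ℝ} (hε : 0 < ε)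
    {i : ℕ × (Fin d → ℤ)} (h : sel f ε l i) :
    ∫ x in cube ε i, ‖f x‖ ≤ 2 ^ d * l * len ε i ^ d := by
  obtain ⟨x, hx⟩ := cube_nonempty hε i
  have h1 := h.2 x hx (i.1 + 1) (by omega)
  unfold avgN at h1
  have hp := len_pos hε (i.1 + 1, cq ε (i.1 + 1) x)
  rw [inv_mul_eq_div, div_le_iff₀ (by positivity)] at h1
  have hsub : cube ε i ⊆ cube ε (i.1 + 1, cq ε (i.1 + 1) x) := by
    intro y hy
    exact cq_nested ε (Nat.le_succ i.1) (hy.trans hx.symm)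
  calc ∫ x in cube ε i, ‖f x‖ ≤ ∫ x in cube ε (i.1 + 1, cq ε (i.1 + 1) x), ‖f x‖ := by
        apply setIntegral_mono_set hf.norm.integrableOn
        · filter_upwards with x
          exact norm_nonneg _
        · exact hsub.eventuallyLE
    _ ≤ _ := h1
    _ = _ := by
        unfold len
        simp only
        rw [pow_succ, mul_pow, mul_pow, mul_pow]
        ring

lemma sel_finite {f : Ed d → ℂ} (hf : Integrable f) {ε l : ℝ} (hε : 0 < ε) (hl : 0 < l) :
    {i | sel f ε l i}.Finite := by
  by_contra hinf
  obtain ⟨n, hn⟩ := exists_nat_gt ((∫ x, ‖f x‖) / (l * ε ^ d))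
  obtain ⟨t, ht, hcard⟩ := Set.Infinite.exists_subset_card_eq hinf n
  have h1 : ∑ i ∈ t, ∫ x in cube ε i, ‖f x‖ ≤ ∫ x, ‖f x‖ := by
    rw [← integral_biUnion_finset t (fun i _ => cube_measurable hε i)]
    · exact setIntegral_le_integral hf.norm (by filter_upwards with x; exact norm_nonneg _)
    · intro i hi i' hi' hne
      exact sel_disjoint (ht hi) (ht hi') hne
    · intro i _
      exact hf.norm.integrableOn
  have h2 : (n : ℝ) * (l * ε ^ d) ≤ ∑ i ∈ t, ∫ x in cube ε i, ‖f x‖ := by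
    rw [← hcard, ← nsmul_eq_mul]
    apply Finset.card_nsmul_le_sum
    intro i hi
    refine le_trans ?_ (sel_lower hε (ht hi))
    gcongr
    unfold len
    have : (1:ℝ) ≤ 2 ^ i.1 := one_le_pow₀ (by norm_num)
    nlinarith
  rw [div_lt_iff₀ (by positivity)] at hn
  linarith


/-- the finite set of selected cubes -/
def selT {f : Ed d → ℂ} (hf : Integrable f) {ε l : ℝ} (hε : 0 < ε) (hl : 0 < l) :
    Finset (ℕ × (Fin d → ℤ)) := (sel_finite hf hε hl).toFinset

lemma mem_selT {f : Ed d → ℂ} (hf : Integrable f) {ε l : ℝ} (hε : 0 < ε) (hl : 0 < l)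
    (i : ℕ × (Fin d → ℤ)) : i ∈ selT hf hε hl ↔ sel f ε l i := by
  simp [selT]

/-- complex average -/
def avgC (f : Ed d → ℂ) (ε : ℝ) (i : ℕ × (Fin d → ℤ)) : ℂ :=
  (((len ε i ^ d)⁻¹ : ℝ) : ℂ) * ∫ x in cube ε i, f x

/-- good part -/
def good {f : Ed d → ℂ} (hf : Integrable f) {ε l : ℝ} (hε : 0 < ε) (hl : 0 < l) (x : Ed d) : ℂ :=
  f x + ∑ i ∈ selT hf hε hl, (cube ε i).indicator (fun y => avgC f ε i - f y) x


lemma cube_piece_integrable {f : Ed d → ℂ} (hf : Integrable f) {ε : ℝ} (hε : 0 < ε) (i : ℕ × (Fin d → ℤ)) :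
    Integrable ((cube ε i).indicator (fun y => avgC f ε i - f y)) := by
  rw [integrable_indicator_iff (cube_measurable hε i)]
  refine Integrable.sub ?_ hf.integrableOn
  refine integrableOn_const ?_
  rw [cube_volume hε]; exact ENNReal.ofReal_ne_top

lemma cube_piece_integral {f : Ed d → ℂ} (hf : Integrable f) {ε : ℝ} (hε : 0 < ε) (i : ℕ × (Fin d → ℤ)) :
    ∫ y in cube ε i, (avgC f ε i - f y) = 0 := by
  have h1 : IntegrableOn (fun _ : Ed d => avgC f ε i) (cube ε i) := by
    refine integrableOn_const ?_
    rw [cube_volume hε]; exact ENNReal.ofReal_ne_top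
  rw [integral_sub h1 hf.integrableOn, setIntegral_const, cube_volume_real hε, avgC]
  have := len_pos hε i
  have h2 : (((len ε i ^ d : ℝ)) : ℂ) ≠ 0 := by
    exact_mod_cast (pow_pos this d).ne'
  rw [Complex.real_smul, ← mul_assoc, ← Complex.ofReal_mul, mul_inv_cancel₀ (pow_pos this d).ne']
  simp

lemma good_integrable {f : Ed d → ℂ} (hf : Integrable f) {ε l : ℝ} (hε : 0 < ε) (hl : 0 < l) : Integrable (good hf hε hl) := by
  unfold good
  exact hf.add (integrable_finsetSum _ fun i _ => cube_piece_integrable hf hε i)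

lemma good_on {f : Ed d → ℂ} (hf : Integrable f) {ε l : ℝ} (hε : 0 < ε) (hl : 0 < l) {i : ℕ × (Fin d → ℤ)} (hi : sel f ε l i) {x : Ed d} (hx : x ∈ cube ε i) :
    good hf hε hl x = avgC f ε i := by
  unfold good
  rw [Finset.sum_eq_single i]
  · rw [indicator_of_mem hx]; ring
  · intro k hk hne
    apply indicator_of_notMem
    intro hxk
    exact Set.disjoint_left.1 (sel_disjoint ((mem_selT hf hε hl k).1 hk) hi hne) hxk hx
  · intro h; exact absurd ((mem_selT hf hε hl i).2 hi) h

lemma good_off {f : Ed d → ℂ} (hf : Integrable f) {ε l : ℝ} (hε : 0 < ε) (hl : 0 < l) {x : Ed d} (hx : ∀ i, sel f ε l i → x ∉ cube ε i) :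
    good hf hε hl x = f x := by
  unfold good
  rw [Finset.sum_eq_zero, add_zero]
  intro i hi
  exact indicator_of_notMem (hx i ((mem_selT hf hε hl i).1 hi)) _

lemma avgC_le {f : Ed d → ℂ} (hf : Integrable f) {ε l : ℝ} (hε : 0 < ε) {i : ℕ × (Fin d → ℤ)} (hi : sel f ε l i) : ‖avgC f ε i‖ ≤ 2 ^ d * l := by
  have hp := pow_pos (len_pos hε i) d
  unfold avgC
  rw [norm_mul, Complex.norm_real, Real.norm_eq_abs, abs_of_pos (inv_pos.2 hp), inv_mul_le_iff₀ hp]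
  refine (norm_integral_le_integral_norm _).trans ((sel_upper hf hε hi).trans (le_of_eq (by ring)))

lemma good_le {f : Ed d → ℂ} (hf : Integrable f) {ε l : ℝ} (hε : 0 < ε) (hl : 0 < l) (hd : 1 ≤ d) (hosc : ∀ x y : Ed d, ‖x - y‖ ≤ d * ε → ‖f x - f y‖ ≤ l) (x : Ed d) :
    ‖good hf hε hl x‖ ≤ 2 ^ d * l := by
  by_cases hx : ∃ i, sel f ε l i ∧ x ∈ cube ε i
  · obtain ⟨i, hi, hxi⟩ := hx
    rw [good_on hf hε hl hi hxi]
    exact avgC_le hf hε hi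
  push Not at hx
  rw [good_off hf hε hl hx]
  have h0 : avgN f ε (0, cq ε 0 x) ≤ l := by
    by_contra h
    push Not at h
    obtain ⟨m, hm⟩ := sel_of_gt hd hf hε hl h
    exact hx _ hm (mem_cube_self ε m x)
  have hp := pow_pos (len_pos hε ((0, cq ε 0 x) : ℕ × (Fin d → ℤ))) d
  unfold avgN at h0
  rw [inv_mul_le_iff₀ hp] at h0
  have hfin : volume (cube ε ((0, cq ε 0 x) : ℕ × (Fin d → ℤ))) ≠ ⊤ := by
    rw [cube_volume hε]; exact ENNReal.ofReal_ne_top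
  have h1 : ∫ y in cube ε (0, cq ε 0 x), (‖f x‖ - l) ≤ ∫ y in cube ε (0, cq ε 0 x), ‖f y‖ := by
    refine setIntegral_mono_on (integrableOn_const hfin) hf.norm.integrableOn (cube_measurable hε _) ?_
    intro y hy
    have h2 := hosc x y (by simpa [len] using cube_dist hε _ (mem_cube_self ε 0 x) hy)
    have := norm_sub_norm_le (f x) (f y)
    linarith
  rw [setIntegral_const, cube_volume_real hε, smul_eq_mul] at h1
  have h3 := le_of_mul_le_mul_left (h1.trans h0) hp
  have h4 : (2:ℝ) ^ 1 ≤ 2 ^ d := pow_le_pow_right₀ (by norm_num) hd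
  nlinarith

lemma good_integral {f : Ed d → ℂ} (hf : Integrable f) {ε l : ℝ} (hε : 0 < ε) {l' : ℝ} (hll : l ≤ l') (hl' : 0 < l') {i : ℕ × (Fin d → ℤ)} (hi : sel f ε l i) :
    ∫ x in cube ε i, good hf hε hl' x = ∫ x in cube ε i, f x := by
  unfold good
  rw [integral_add hf.integrableOn (integrable_finsetSum _ fun k _ =>
    (cube_piece_integrable hf hε k).integrableOn), integral_finsetSum _ fun k _ =>
    (cube_piece_integrable hf hε k).integrableOn, Finset.sum_eq_zero, add_zero]
  intro k hk
  have hk' := (mem_selT hf hε hl' k).1 hk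
  rw [setIntegral_indicator (cube_measurable hε k)]
  by_cases h : ∃ x, x ∈ cube ε i ∧ x ∈ cube ε k
  · obtain ⟨x, hx, hx'⟩ := h
    rw [inter_eq_right.2 (sel_compare hll hi hk' hx hx'), cube_piece_integral hf hε]
  · push Not at h
    have : cube ε i ∩ cube ε k = ∅ := by
      ext x; simp; exact h x
    rw [this]; simp

lemma good_none {f : Ed d → ℂ} (hf : Integrable f) {ε l : ℝ} (hε : 0 < ε) (hl : 0 < l) (hb : ∀ x, ‖f x‖ ≤ l) : good hf hε hl = f := by
  funext x
  apply good_off hf hε hl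
  intro i hi _
  have h1 := hi.1
  unfold avgN at h1
  have hp := pow_pos (len_pos hε i) d
  rw [lt_inv_mul_iff₀ hp] at h1
  have hfin : volume (cube ε i) ≠ ⊤ := by
    rw [cube_volume hε]; exact ENNReal.ofReal_ne_top
  have h2 : ∫ y in cube ε i, ‖f y‖ ≤ ∫ y in cube ε i, l :=
    setIntegral_mono hf.norm.integrableOn (integrableOn_const hfin) hb
  rw [setIntegral_const, cube_volume_real hε, smul_eq_mul] at h2
  linarith

/-- difference of good parts -/
lemma diff_off {f : Ed d → ℂ} (hf : Integrable f) {ε l : ℝ} (hε : 0 < ε) (hl : 0 < l) (hd : 1 ≤ d) {l' : ℝ} (hll : l ≤ l') (hl' : 0 < l') {x : Ed d}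
    (hx : ∀ i, sel f ε l i → x ∉ cube ε i) :
    good hf hε hl' x - good hf hε hl x = 0 := by
  rw [good_off hf hε hl hx, good_off hf hε hl', sub_self]
  intro i hi hxi
  have h1 : l < avgN f ε (i.1, cq ε i.1 x) := by
    have : ((i.1, cq ε i.1 x) : ℕ × (Fin d → ℤ)) = i := by
      ext1
      · rfl
      · exact hxi
    rw [this]; exact hll.trans_lt hi.1
  obtain ⟨m, hm⟩ := sel_of_gt hd hf hε hl h1
  exact hx _ hm (mem_cube_self ε m x)

lemma cube_count {f : Ed d → ℂ} (hf : Integrable f) {ε l : ℝ} (hε : 0 < ε) (i : ℕ × (Fin d → ℤ)) (hi : sel f ε l i) (hl : 0 < l) :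
    ENNReal.ofReal (l / 2) * ENNReal.ofReal (len ε i ^ d) ≤
      ∫⁻ x in cube ε i, ({x | l / 2 < ‖f x‖}.indicator (fun x => ‖f x‖ₑ)) x := by
  have hp := pow_pos (len_pos hε i) d
  have h1 : ENNReal.ofReal l * ENNReal.ofReal (len ε i ^ d) ≤ ∫⁻ x in cube ε i, ‖f x‖ₑ := by
    rw [← ENNReal.ofReal_mul hl.le, ← ofReal_integral_norm_eq_lintegral_enorm hf.integrableOn]
    exact ENNReal.ofReal_le_ofReal (sel_lower hε hi)
  have h2 : ∫⁻ x in cube ε i, ‖f x‖ₑ ≤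
      ∫⁻ x in cube ε i, (ENNReal.ofReal (l / 2) + ({x | l / 2 < ‖f x‖}.indicator (fun x => ‖f x‖ₑ)) x) := by
    refine lintegral_mono fun x => ?_
    by_cases h : l / 2 < ‖f x‖
    · rw [indicator_of_mem (by exact h)]; exact le_add_self
    · push Not at h
      refine le_trans ?_ le_self_add
      rw [← ofReal_norm]
      exact ENNReal.ofReal_le_ofReal h
  rw [lintegral_add_left measurable_const, setLIntegral_const, cube_volume hε] at h2
  have h3 : ENNReal.ofReal l = ENNReal.ofReal (l / 2) + ENNReal.ofReal (l / 2) := by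
    rw [← ENNReal.ofReal_add (by positivity) (by positivity)]; congr 1; ring
  rw [h3, add_mul] at h1
  exact (ENNReal.add_le_add_iff_left (ENNReal.mul_ne_top ENNReal.ofReal_ne_top ENNReal.ofReal_ne_top)).1
    (h1.trans h2)

lemma cube_count_sum {f : Ed d → ℂ} (hf : Integrable f) {ε l : ℝ} (hε : 0 < ε) (hl : 0 < l) :
    ENNReal.ofReal (l / 2) * ∑ i ∈ selT hf hε hl, ENNReal.ofReal (len ε i ^ d) ≤
      ∫⁻ x, ({x | l / 2 < ‖f x‖}.indicator (fun x => ‖f x‖ₑ)) x := by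
  rw [Finset.mul_sum]
  refine (Finset.sum_le_sum fun i hi => cube_count hf hε i ((mem_selT hf hε hl i).1 hi) hl).trans ?_
  rw [← lintegral_biUnion_finset]
  · exact setLIntegral_le_lintegral _ _
  · intro i hi k hk hne
    exact sel_disjoint ((mem_selT hf hε hl i).1 hi) ((mem_selT hf hε hl k).1 hk) hne
  · exact fun i _ => cube_measurable hε i

lemma diff_decomp {f : Ed d → ℂ} (hf : Integrable f) {ε l : ℝ} (hε : 0 < ε) (hl : 0 < l)
    (hd : 1 ≤ d) {l' : ℝ} (hll : l ≤ l') (hl' : 0 < l') (x : Ed d) :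
    good hf hε hl' x - good hf hε hl x = ∑ i ∈ selT hf hε hl,
      (cube ε i).indicator (fun y => good hf hε hl' y - good hf hε hl y) x := by
  by_cases hx : ∃ i, sel f ε l i ∧ x ∈ cube ε i
  · obtain ⟨i, hi, hxi⟩ := hx
    rw [Finset.sum_eq_single i]
    · rw [indicator_of_mem hxi]
    · intro k hk hne
      apply indicator_of_notMem
      intro hxk
      exact Set.disjoint_left.1 (sel_disjoint ((mem_selT hf hε hl k).1 hk) hi hne) hxk hxi
    · intro h; exact absurd ((mem_selT hf hε hl i).2 hi) h
  · push Not at hx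
    rw [diff_off hf hε hl hd hll hl' hx, Finset.sum_eq_zero]
    intro i hi
    exact indicator_of_notMem (hx i ((mem_selT hf hε hl i).1 hi)) _


lemma Tj_add (μ : Measure (Ed d)) [IsFiniteMeasure μ] {β : ℝ → ℝ} (hβ : Continuous β)
    (hβsupp : Function.support β ⊆ Ioo (1/2 : ℝ) 2) (j : ℕ) {h1 h2 : Ed d → ℂ}
    (hh1 : Integrable h1) (hh2 : Integrable h2) {t : ℝ} (ht : 0 < t) (x : Ed d) :
    Tj μ β j t (fun y => h1 y + h2 y) x = Tj μ β j t h1 x + Tj μ β j t h2 x := by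
  have hF : ∀ ξ, 𝓕 (fun y => h1 y + h2 y) ξ = 𝓕 h1 ξ + 𝓕 h2 ξ := by
    intro ξ
    have := VectorFourier.fourierIntegral_add (μ := (volume : Measure (Ed d))) (L := innerₗ (Ed d))
      Real.continuous_fourierChar (by simpa using continuous_inner) hh1 hh2
    exact congrFun this ξ
  have hI : ∀ {h : Ed d → ℂ}, Integrable h → Integrable (fun ξ =>
      Complex.exp (2 * (π : ℂ) * Complex.I * ((⟪x, ξ⟫ : ℝ) : ℂ)) *
    (((β ((2:ℝ) ^ (-(j:ℤ)) * ‖t • ξ‖) : ℝ) : ℂ) * mFT μ (t • ξ)) * 𝓕 h ξ) := by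
    intro h hh
    have h1 := (mjF_supp μ hβsupp j h ht).mul_left
      (f := fun ξ => Complex.exp (2 * (π : ℂ) * Complex.I * ((⟪x, ξ⟫ : ℝ) : ℂ)))
    have h2 := mjF_cont μ hβ j hh t
    have h3 : Continuous ((fun ξ => Complex.exp (2 * (π : ℂ) * Complex.I * ((⟪x, ξ⟫ : ℝ) : ℂ))) *
      (fun ξ => mj μ β j (t • ξ) * 𝓕 h ξ)) := by
      refine Continuous.mul ?_ h2
      fun_prop
    have h4 := h3.integrable_of_hasCompactSupport h1 (μ := volume)
    refine h4.congr ?_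
    filter_upwards with ξ
    simp only [Pi.mul_apply, mj]
    ring
  unfold Tj
  rw [← integral_add (hI hh1) (hI hh2)]
  congr 1
  ext ξ
  rw [hF]
  ring

lemma TjStar_add (μ : Measure (Ed d)) [IsFiniteMeasure μ] {β : ℝ → ℝ} (hβ : Continuous β)
    (hβsupp : Function.support β ⊆ Ioo (1/2 : ℝ) 2) (j : ℕ) {h1 h2 : Ed d → ℂ}
    (hh1 : Integrable h1) (hh2 : Integrable h2) (x : Ed d) :
    TjStar μ β j (fun y => h1 y + h2 y) x ≤ TjStar μ β j h1 x + TjStar μ β j h2 x := by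
  refine iSup_le fun t => ?_
  rw [Tj_add μ hβ hβsupp j hh1 hh2 t.2]
  refine le_trans (b := (‖Tj μ β j t h1 x‖₊ : ℝ≥0∞) + (‖Tj μ β j t h2 x‖₊ : ℝ≥0∞)) (by exact_mod_cast nnnorm_add_le _ _) ?_
  exact add_le_add (le_iSup (fun t : {t : ℝ // 0 < t} => (‖Tj μ β j t h1 x‖₊ : ℝ≥0∞)) t)
    (le_iSup (fun t : {t : ℝ // 0 < t} => (‖Tj μ β j t h2 x‖₊ : ℝ≥0∞)) t)

lemma TjStar_zero (μ : Measure (Ed d)) (β : ℝ → ℝ) (j : ℕ) (x : Ed d) :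
    TjStar μ β j (fun _ => 0) x = 0 := by
  have : ∀ ξ, 𝓕 (fun _ : Ed d => (0:ℂ)) ξ = 0 := by
    intro ξ
    rw [Real.fourier_eq]; simp
  simp [TjStar, Tj, this]

lemma TjStar_sum (μ : Measure (Ed d)) [IsFiniteMeasure μ] {β : ℝ → ℝ} (hβ : Continuous β)
    (hβsupp : Function.support β ⊆ Ioo (1/2 : ℝ) 2) (j : ℕ) {ι : Type*} (s : Finset ι)
    {h : ι → Ed d → ℂ} (hh : ∀ i ∈ s, Integrable (h i)) (x : Ed d) :
    TjStar μ β j (fun y => ∑ i ∈ s, h i y) x ≤ ∑ i ∈ s, TjStar μ β j (h i) x := by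
  classical
  induction s using Finset.induction_on with
  | empty => simp [TjStar_zero]
  | insert a s ha ih =>
    simp only [Finset.sum_insert ha]
    refine (TjStar_add μ hβ hβsupp j (hh a (by simp)) (integrable_finsetSum s fun i hi =>
      hh i (by simp [hi])) x).trans ?_
    gcongr
    exact ih fun i hi => hh i (by simp [hi])

lemma TjStar_sup (μ : Measure (Ed d)) [IsFiniteMeasure μ] {β : ℝ → ℝ}
    (hβsm : ContDiff ℝ (⊤ : ℕ∞) β) (hβsupp : Function.support β ⊆ Ioo (1/2 : ℝ) 2) :
    ∃ C : ℝ, 0 ≤ C ∧ ∀ (j : ℕ) (h : Ed d → ℂ) (A : ℝ), 0 ≤ A → Integrable h → (∀ z, ‖h z‖ ≤ A) →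
      ∀ x, TjStar μ β j h x ≤ ENNReal.ofReal (C * A) := by
  obtain ⟨ψ, hψ⟩ := exists_psi (d := d) hβsm hβsupp
  have hψb : ∃ B, ∀ w, ‖ψ w‖ ≤ B := by
    obtain ⟨B, _, hB⟩ := schwartz_decay0 ψ 0
    exact ⟨B, fun w => by simpa using hB w⟩
  have hψi : Integrable (fun w => ‖ψ w‖) := by simpa using schwartz_int ψ 0
  have hJ0 : 0 ≤ ∫ w, ‖ψ w‖ := integral_nonneg (fun w => by positivity)
  refine ⟨μ.real univ * ∫ w, ‖ψ w‖, by positivity, ?_⟩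
  intro j h A hA hh hb x
  refine iSup_le fun t => ?_
  obtain ⟨t, ht⟩ := t
  rw [Tj_repr μ hβsm.continuous hβsupp ψ.continuous hψb hψ j hh ht x]
  set δ := (2:ℝ) ^ (-(j:ℤ)) * t with hδ
  have hδ0 : 0 < δ := by positivity
  have key : ∀ u : Ed d, ‖∫ z, (((δ ^ d)⁻¹ : ℝ) : ℂ) * ψ (δ⁻¹ • (u - z)) * h z‖ ≤
      (∫ w, ‖ψ w‖) * A := by
    intro u
    have hi : Integrable (fun z => (δ ^ d)⁻¹ * ‖ψ (δ⁻¹ • (u - z))‖ * A) := by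
      refine Integrable.mul_const (Integrable.const_mul ?_ _) _
      have := (hψi.comp_smul (R := δ⁻¹) (by positivity))
      exact this.comp_sub_left u
    have h1 : ∫ z, (δ ^ d)⁻¹ * ‖ψ (δ⁻¹ • (u - z))‖ * A = (∫ w, ‖ψ w‖) * A := by
      rw [integral_mul_const, integral_const_mul,
        integral_sub_left_eq_self (fun z => ‖ψ (δ⁻¹ • z)‖) volume u,
        Measure.integral_comp_smul_of_nonneg volume (fun z => ‖ψ z‖) δ⁻¹ (hR := by positivity),
        finrank_euclideanSpace_fin, smul_eq_mul, inv_pow, inv_inv, ← mul_assoc,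
        inv_mul_cancel₀ (by positivity), one_mul]
    rw [← h1]
    refine (norm_integral_le_integral_norm _).trans ?_
    refine integral_mono_of_nonneg (Filter.Eventually.of_forall fun z => norm_nonneg _) hi ?_
    filter_upwards with z
    rw [norm_mul, norm_mul, Complex.norm_real, Real.norm_of_nonneg (by positivity)]
    gcongr
    exact hb z
  have h2 : ‖∫ y, (∫ z, (((δ ^ d)⁻¹ : ℝ) : ℂ) * ψ (δ⁻¹ • (x - t • y - z)) * h z) ∂μ‖ ≤
      ((∫ w, ‖ψ w‖) * A) * μ.real univ := norm_integral_le_of_norm_le_const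
      (Filter.Eventually.of_forall fun y => key (x - t • y))
  rw [show ∀ z : ℂ, (‖z‖₊ : ℝ≥0∞) = ENNReal.ofReal ‖z‖ from fun z => (ofReal_norm z).symm]
  refine ENNReal.ofReal_le_ofReal (h2.trans (le_of_eq (by ring)))


lemma memLp_two_of_bdd {h : Ed d → ℂ} (hh : Integrable h) {A : ℝ} (hb : ∀ z, ‖h z‖ ≤ A) :
    MemLp h 2 := by
  rw [memLp_two_iff_integrable_sq_norm hh.aestronglyMeasurable]
  refine (hh.norm.const_mul A).mono' (hh.aestronglyMeasurable.norm.pow 2) ?_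
  filter_upwards with x
  rw [Real.norm_of_nonneg (by positivity), sq]
  exact mul_le_mul_of_nonneg_right (hb x) (norm_nonneg _)

/-- the truncated mass -/
def Wl (f : Ed d → ℂ) (l : ℝ) : ℝ≥0∞ :=
  ∫⁻ x, ({x | l / 2 < ‖f x‖}.indicator (fun x => ‖f x‖ₑ)) x

/-- difference of consecutive good parts -/
def Dl {f : Ed d → ℂ} (hf : Integrable f) {ε l : ℝ} (hε : 0 < ε) (hl : 0 < l) : Ed d → ℂ :=
  fun y => good hf hε (l := 2 * l) (mul_pos two_pos hl) y - good hf hε hl y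

lemma level_est (hd : 1 ≤ d) (μ : Measure (Ed d)) [IsFiniteMeasure μ]
    (hcomp : ∃ K : Set (Ed d), IsCompact K ∧ μ Kᶜ = 0) {a C : ℝ} (ha : 0 < a)
    (hdecay : ∀ ξ : Ed d, ξ ≠ 0 → ‖mFT μ ξ‖ ≤ C * ‖ξ‖ ^ (-a))
    {β : ℝ → ℝ} (hβsm : ContDiff ℝ (⊤ : ℕ∞) β)
    (hβsupp : Function.support β ⊆ Ioo (1/2 : ℝ) 2) :
    ∃ M : ℝ, 0 ≤ M ∧ ∀ (j : ℕ) (f : Ed d → ℂ) (hf : Integrable f volume) (ε l : ℝ) (hε : 0 < ε)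
      (hl : 0 < l),
      (∀ x y : Ed d, ‖x - y‖ ≤ d * ε → ‖f x - f y‖ ≤ l) →
      (∫⁻ x, TjStar μ β j (Dl hf hε hl) x ≤
        ENNReal.ofReal (M * 2 ^ (j : ℝ)) * Wl f l) ∧
      (∫⁻ x, TjStar μ β j (Dl hf hε hl) x ^ 2 ≤
        ENNReal.ofReal (M * 2 ^ ((1 - 2 * a) * (j : ℝ)) * l) * Wl f l) := by
  obtain ⟨C1, hC1, h1⟩ := atom_star μ hcomp hβsm hβsupp
  have hcomp2 : ∃ R : ℝ, 0 < R ∧ ∀ᵐ y ∂μ, ‖y‖ ≤ R := by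
    obtain ⟨S, hS, hSμ⟩ := hcomp
    obtain ⟨R0, hR0⟩ := hS.isBounded.exists_norm_le
    refine ⟨max R0 1, by positivity, ?_⟩
    have : ∀ᵐ y ∂μ, y ∈ S := by
      rw [ae_iff]; exact hSμ
    filter_upwards [this] with y hy
    exact (hR0 y hy).trans (le_max_left _ _)
  obtain ⟨C2, hC2, h2⟩ := L2_star hd μ hcomp2 ha hdecay hβsm hβsupp
  have hd0 : (0:ℝ) < d := by exact_mod_cast hd
  refine ⟨C1 * (3 * 2 ^ d) * d ^ d * 2 + C2 * (3 * 2 ^ d) ^ 2 * 2, by positivity, ?_⟩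
  intro j f hf ε l hε hl hosc
  have hl2 : 0 < 2 * l := mul_pos two_pos hl
  set D : Ed d → ℂ := Dl hf hε hl with hD
  have hDi : Integrable D := (good_integrable hf hε hl2).sub (good_integrable hf hε hl)
  have hDb : ∀ x, ‖D x‖ ≤ 3 * 2 ^ d * l := by
    intro x
    have e1 := good_le hf hε hl hd hosc x
    have e2 := good_le hf hε hl2 hd (fun x y h => (hosc x y h).trans (by linarith)) x
    refine (norm_sub_le _ _).trans ?_
    linarith
  have hll : l ≤ 2 * l := by linarith
  have hdec := diff_decomp hf hε hl hd hll hl2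
  have hcount : ENNReal.ofReal (l / 2) * ∑ i ∈ selT hf hε hl, ENNReal.ofReal (len ε i ^ d) ≤ Wl f l :=
    cube_count_sum hf hε hl
  have ai : ∀ i, Integrable ((cube ε i).indicator D) := fun i => hDi.indicator (cube_measurable hε i)
  constructor
  · have e1 : ∀ x, TjStar μ β j D x ≤ ∑ i ∈ selT hf hε hl, TjStar μ β j ((cube ε i).indicator D) x := by
      intro x
      have : D = fun y => ∑ i ∈ selT hf hε hl, (cube ε i).indicator D y := funext hdec
      conv_lhs => rw [this]
      exact TjStar_sum μ hβsm.continuous hβsupp j _ (fun i _ => ai i) x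
    refine (lintegral_mono e1).trans ?_
    rw [lintegral_finsetSum _ fun i _ => TjStar_measurable μ hβsm.continuous hβsupp j (ai i)]
    have e2 : ∀ i ∈ selT hf hε hl, ∫⁻ x, TjStar μ β j ((cube ε i).indicator D) x ≤
        ENNReal.ofReal (C1 * (3 * 2 ^ d) * d ^ d * 2 * 2 ^ (j : ℝ)) *
          (ENNReal.ofReal (l / 2) * ENNReal.ofReal (len ε i ^ d)) := by
      intro i hi
      have hi' := (mem_selT hf hε hl i).1 hi
      obtain ⟨c, hc⟩ := cube_nonempty hε i
      have hlen := len_pos hε i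
      refine (h1 j _ c (d * len ε i) (3 * 2 ^ d * l) (by positivity) (by positivity) (ai i) ?_ ?_ ?_).trans
        (le_of_eq ?_)
      · intro z
        refine (norm_indicator_le_norm_self _ _).trans (hDb z)
      · intro z hz
        apply indicator_of_notMem
        intro hzc
        apply hz
        rw [mem_closedBall, dist_eq_norm]
        exact cube_dist hε i hzc hc
      · rw [integral_indicator (cube_measurable hε i)]
        unfold Dl at hD
        rw [hD, integral_sub (good_integrable hf hε hl2).integrableOn (good_integrable hf hε hl).integrableOn,
          good_integral hf hε hll hl2 hi', good_integral hf hε le_rfl hl hi', sub_self]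
      · rw [← ENNReal.ofReal_mul (by positivity), ← ENNReal.ofReal_mul (by positivity), Real.rpow_natCast]
        congr 1
        rw [mul_pow]; ring
    refine (Finset.sum_le_sum e2).trans ?_
    rw [← Finset.mul_sum, ← Finset.mul_sum]
    refine mul_le_mul' (ENNReal.ofReal_le_ofReal ?_) hcount
    have : 0 ≤ C2 * (3 * 2 ^ d) ^ 2 * 2 * 2 ^ (j : ℝ) := by positivity
    rw [add_mul]
    exact le_add_of_nonneg_right this
  · refine (h2 j D hDi (memLp_two_of_bdd hDi hDb)).trans ?_
    have e1 : ∫⁻ x, ‖D x‖ₑ ^ 2 ≤ ∑ i ∈ selT hf hε hl,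
        ENNReal.ofReal ((3 * 2 ^ d * l) ^ 2) * ENNReal.ofReal (len ε i ^ d) := by
      have e2 : ∀ x, ‖D x‖ₑ ^ 2 ≤ ∑ i ∈ selT hf hε hl,
          (cube ε i).indicator (fun _ => ENNReal.ofReal ((3 * 2 ^ d * l) ^ 2)) x := by
        intro x
        by_cases hx : ∃ i, sel f ε l i ∧ x ∈ cube ε i
        · obtain ⟨i, hi, hxi⟩ := hx
          refine le_trans ?_ (Finset.single_le_sum (fun _ _ => zero_le) ((mem_selT hf hε hl i).2 hi))
          rw [indicator_of_mem hxi, ENNReal.ofReal_pow (by positivity), ← ofReal_norm]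
          gcongr
          exact hDb x
        · push Not at hx
          have : D x = 0 := diff_off hf hε hl hd hll hl2 hx
          rw [this]; simp
      refine (lintegral_mono e2).trans ?_
      rw [lintegral_finsetSum _ fun i _ => measurable_const.indicator (cube_measurable hε i)]
      refine Finset.sum_le_sum fun i _ => ?_
      rw [lintegral_indicator (cube_measurable hε i), setLIntegral_const, cube_volume hε]
    refine (mul_le_mul' le_rfl e1).trans ?_
    rw [← Finset.mul_sum]
    have e3 : ENNReal.ofReal ((3 * 2 ^ d * l) ^ 2) =
        ENNReal.ofReal ((3 * 2 ^ d) ^ 2 * 2 * l) * ENNReal.ofReal (l / 2) := by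
      rw [← ENNReal.ofReal_mul (by positivity)]; congr 1; ring
    rw [e3, mul_assoc, ← mul_assoc, ← ENNReal.ofReal_mul (by positivity)]
    refine mul_le_mul' (ENNReal.ofReal_le_ofReal ?_) hcount
    have : 0 ≤ C1 * (3 * 2 ^ d) * d ^ d * 2 * 2 ^ ((1 - 2 * a) * (j : ℝ)) * l := by positivity
    refine (le_add_of_nonneg_right this).trans (le_of_eq ?_)
    ring


lemma geom_sum_rpow_le {q : ℝ} (hq : 0 < q) {w : ℝ} (hw : 0 < w) (n : ℕ) :
    ∑ m ∈ Finset.range n, (w * 2 ^ m) ^ q ≤ (2 ^ q - 1)⁻¹ * (w * 2 ^ n) ^ q := by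
  have h2 : 0 < (2:ℝ) ^ q - 1 := by
    have := Real.one_lt_rpow (x := 2) (by norm_num) hq
    linarith
  induction n with
  | zero => simp; positivity
  | succ n ih =>
    rw [Finset.sum_range_succ]
    refine (add_le_add_left ih _).trans (le_of_eq ?_)
    rw [pow_succ, ← mul_assoc, Real.mul_rpow (by positivity) (by norm_num : (0:ℝ) ≤ 2)]
    field_simp
    ring

lemma geom_filter {q : ℝ} (hq : 0 < q) {w : ℝ} (hw : 0 < w) (n : ℕ) {y : ℝ} (hy : 0 ≤ y) :
    ∑ m ∈ Finset.range n, (if w * 2 ^ m ≤ y then (w * 2 ^ m) ^ q else 0) ≤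
      (2 ^ q - 1)⁻¹ * 2 ^ q * y ^ q := by
  have h2 : 0 < (2:ℝ) ^ q - 1 := by
    have := Real.one_lt_rpow (x := 2) (by norm_num) hq
    linarith
  induction n with
  | zero => simp; positivity
  | succ n ih =>
    by_cases h : w * 2 ^ n ≤ y
    · have e1 : ∑ m ∈ Finset.range (n + 1), (if w * 2 ^ m ≤ y then (w * 2 ^ m) ^ q else 0) ≤
          ∑ m ∈ Finset.range (n + 1), (w * 2 ^ m) ^ q := by
        refine Finset.sum_le_sum fun m _ => ?_
        split_ifs
        · exact le_rfl
        · positivity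
      refine e1.trans ((geom_sum_rpow_le hq hw (n + 1)).trans ?_)
      rw [pow_succ, ← mul_assoc, Real.mul_rpow (by positivity) (by norm_num : (0:ℝ) ≤ 2), mul_assoc,
        mul_comm (2 ^ q : ℝ)]
      gcongr
    · rw [Finset.sum_range_succ, if_neg h, add_zero]
      exact ih

lemma interp_real {p : ℝ} (hp1 : 1 < p) (hp2 : p < 2) {w : ℝ} (hw : 0 < w) (n : ℕ) (u : ℕ → ℝ)
    (hu : ∀ m, 0 ≤ u m) :
    (∑ m ∈ Finset.range n, u m) ^ p ≤ (2 + (2 ^ (2 - p) - 1)⁻¹ * 2 ^ (2 - p)) *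
      ∑ m ∈ Finset.range n, ((w * 2 ^ m) ^ (p - 1) * u m + (w * 2 ^ m) ^ (p - 2) * u m ^ 2) := by
  set c : ℝ := (2 ^ (2 - p) - 1)⁻¹ * 2 ^ (2 - p) with hc
  have h2 : 0 < (2:ℝ) ^ (2 - p) - 1 := by
    have := Real.one_lt_rpow (x := 2) (by norm_num) (by linarith : 0 < 2 - p)
    linarith
  have hc0 : 0 < c := by positivity
  set S := ∑ m ∈ Finset.range n, u m with hS
  have hS0 : 0 ≤ S := Finset.sum_nonneg fun m _ => hu m
  rcases hS0.eq_or_lt with h0 | hSpos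
  · rw [← h0, Real.zero_rpow (by linarith)]
    refine mul_nonneg (by positivity) (Finset.sum_nonneg fun m _ => ?_)
    have := hu m
    positivity
  have key : ∀ m, S ^ (p - 1) * u m ≤ (w * 2 ^ m) ^ (p - 1) * u m +
      (c / 2) * ((w * 2 ^ m) ^ (p - 2) * u m ^ 2) +
      (c⁻¹ / 2 * S ^ (2 * p - 2)) * (if w * 2 ^ m ≤ S then (w * 2 ^ m) ^ (2 - p) else 0) := by
    intro m
    have hum := hu m
    have hwm : 0 < w * 2 ^ m := by positivity
    split_ifs with h
    · have e0 : 0 ≤ (w * 2 ^ m) ^ (p - 1) * u m := by positivity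
      set Z := (w * 2 ^ m) ^ (2 - p) with hZ
      have hZ0 : 0 < Z := by positivity
      have e1 : (w * 2 ^ m) ^ (p - 2) = Z⁻¹ := by
        rw [hZ, ← Real.rpow_neg hwm.le]; congr 1; ring
      have e2 : S ^ (2 * p - 2) = (S ^ (p - 1)) ^ 2 := by
        rw [← Real.rpow_natCast, ← Real.rpow_mul hS0]; congr 1; push_cast; ring
      rw [e1, e2]
      set X := S ^ (p - 1) with hX
      have e3 : (c / 2) * (Z⁻¹ * u m ^ 2) + c⁻¹ / 2 * X ^ 2 * Z - X * u m =
          (c * u m - X * Z) ^ 2 / (2 * c * Z) := by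
        field_simp
        ring
      have e4 : 0 ≤ (c * u m - X * Z) ^ 2 / (2 * c * Z) := by positivity
      linarith
    · push Not at h
      have e1 : S ^ (p - 1) ≤ (w * 2 ^ m) ^ (p - 1) :=
        Real.rpow_le_rpow hS0 h.le (by linarith)
      have e2 := mul_le_mul_of_nonneg_right e1 hum
      have e3 : 0 ≤ (c / 2) * ((w * 2 ^ m) ^ (p - 2) * u m ^ 2) := by positivity
      linarith
  have hsum := Finset.sum_le_sum fun m (_ : m ∈ Finset.range n) => key m
  rw [← Finset.mul_sum, ← hS, Finset.sum_add_distrib, Finset.sum_add_distrib, ← Finset.mul_sum,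
    ← Finset.mul_sum] at hsum
  have hg := geom_filter (by linarith : 0 < 2 - p) hw n hS0
  rw [← hc] at hg
  have e1 : S ^ (p - 1) * S = S ^ p := by
    rw [← Real.rpow_add_one hSpos.ne']; congr 1; ring
  have e2 : (c⁻¹ / 2 * S ^ (2 * p - 2)) * (c * S ^ (2 - p)) = S ^ p / 2 := by
    have : S ^ (2 * p - 2) * S ^ (2 - p) = S ^ p := by
      rw [← Real.rpow_add hSpos]; congr 1; ring
    rw [← this]; field_simp
  have e3 := mul_le_mul_of_nonneg_left hg (by positivity : 0 ≤ c⁻¹ / 2 * S ^ (2 * p - 2))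
  rw [e2] at e3
  rw [e1] at hsum
  rw [Finset.sum_add_distrib]
  have n1 : 0 ≤ ∑ m ∈ Finset.range n, (w * 2 ^ m) ^ (p - 1) * u m :=
    Finset.sum_nonneg fun m _ => by have := hu m; positivity
  have n2 : 0 ≤ ∑ m ∈ Finset.range n, (w * 2 ^ m) ^ (p - 2) * u m ^ 2 :=
    Finset.sum_nonneg fun m _ => by have := hu m; positivity
  nlinarith [mul_nonneg hc0.le n1]

lemma interp_enn {p : ℝ} (hp1 : 1 < p) (hp2 : p < 2) : ∃ K : ℝ, 0 < K ∧ ∀ (w : ℝ), 0 < w →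
    ∀ (n : ℕ) (u : ℕ → ℝ≥0∞),
    (∑ m ∈ Finset.range n, u m) ^ p ≤ ENNReal.ofReal K *
      ∑ m ∈ Finset.range n, (ENNReal.ofReal ((w * 2 ^ m) ^ (p - 1)) * u m +
        ENNReal.ofReal ((w * 2 ^ m) ^ (p - 2)) * u m ^ 2) := by
  have h2 : 0 < (2:ℝ) ^ (2 - p) - 1 := by
    have := Real.one_lt_rpow (x := 2) (by norm_num) (by linarith : 0 < 2 - p)
    linarith
  refine ⟨2 + (2 ^ (2 - p) - 1)⁻¹ * 2 ^ (2 - p), by positivity, ?_⟩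
  set K := 2 + ((2:ℝ) ^ (2 - p) - 1)⁻¹ * 2 ^ (2 - p) with hK
  have hK0 : 0 < K := by positivity
  intro w hw n u
  by_cases htop : ∃ m ∈ Finset.range n, u m = ⊤
  · obtain ⟨m, hm, hmt⟩ := htop
    have : ∑ m ∈ Finset.range n, (ENNReal.ofReal ((w * 2 ^ m) ^ (p - 1)) * u m +
        ENNReal.ofReal ((w * 2 ^ m) ^ (p - 2)) * u m ^ 2) = ⊤ := by
      rw [ENNReal.sum_eq_top]
      refine ⟨m, hm, ?_⟩
      rw [hmt, ENNReal.mul_top]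
      · simp
      · have : 0 < (w * 2 ^ m) ^ (p - 1) := by positivity
        simpa using this
    rw [this, ENNReal.mul_top (by simpa using hK0)]
    exact le_top
  · push Not at htop
    set v : ℕ → ℝ := fun m => (u m).toReal with hv
    have e : ∀ m ∈ Finset.range n, u m = ENNReal.ofReal (v m) := fun m hm =>
      (ENNReal.ofReal_toReal (htop m hm)).symm
    have hv0 : ∀ m, 0 ≤ v m := fun m => ENNReal.toReal_nonneg
    have := ENNReal.ofReal_le_ofReal (interp_real hp1 hp2 hw n v hv0)
    rw [← ENNReal.ofReal_rpow_of_nonneg (Finset.sum_nonneg fun m _ => hv0 m) (by linarith),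
      ENNReal.ofReal_mul hK0.le, ENNReal.ofReal_sum_of_nonneg fun m _ => hv0 m,
      ENNReal.ofReal_sum_of_nonneg] at this
    · rw [Finset.sum_congr rfl e]
      refine this.trans (le_of_eq ?_)
      congr 1
      refine Finset.sum_congr rfl fun m hm => ?_
      have := hv0 m
      rw [e m hm, ENNReal.ofReal_add (by positivity) (by positivity),
        ENNReal.ofReal_mul (by positivity), ENNReal.ofReal_mul (by positivity), ENNReal.ofReal_pow this]
    · intro m _
      have := hv0 m
      positivity


lemma sum_Wl {p : ℝ} (hp1 : 1 < p) : ∃ K : ℝ, 0 < K ∧ ∀ (w : ℝ), 0 < w →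
    ∀ (n : ℕ) (f : Ed d → ℂ), Measurable f →
    ∑ m ∈ Finset.range n, ENNReal.ofReal ((w * 2 ^ m) ^ (p - 1)) * Wl f (w * 2 ^ m) ≤
      ENNReal.ofReal K * ∫⁻ x, ‖f x‖ₑ ^ p := by
  have h2 : 0 < (2:ℝ) ^ (p - 1) - 1 := by
    have := Real.one_lt_rpow (x := 2) (by norm_num) (by linarith : 0 < p - 1)
    linarith
  refine ⟨(2 ^ (p - 1) - 1)⁻¹ * 2 ^ (p - 1) * 2 ^ (p - 1), by positivity, ?_⟩
  intro w hw n f hf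
  have hms : ∀ m : ℕ, Measurable (({x | w * 2 ^ m / 2 < ‖f x‖}.indicator (fun x => ‖f x‖ₑ))) := by
    intro m
    exact hf.enorm.indicator (measurableSet_lt measurable_const hf.norm)
  have e1 : ∀ m ∈ Finset.range n, ENNReal.ofReal ((w * 2 ^ m) ^ (p - 1)) * Wl f (w * 2 ^ m) =
      ∫⁻ x, ENNReal.ofReal ((w * 2 ^ m) ^ (p - 1)) *
        ({x | w * 2 ^ m / 2 < ‖f x‖}.indicator (fun x => ‖f x‖ₑ)) x := by
    intro m _
    rw [lintegral_const_mul _ (hms m), Wl]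
  rw [Finset.sum_congr rfl e1, ← lintegral_finsetSum _ fun m _ => (hms m).const_mul _,
    ← lintegral_const_mul' _ _ ENNReal.ofReal_ne_top]
  refine lintegral_mono fun x => ?_
  have e2 : ∀ m ∈ Finset.range n, ENNReal.ofReal ((w * 2 ^ m) ^ (p - 1)) *
        ({x | w * 2 ^ m / 2 < ‖f x‖}.indicator (fun x => ‖f x‖ₑ)) x ≤
      ENNReal.ofReal (if w * 2 ^ m ≤ 2 * ‖f x‖ then (w * 2 ^ m) ^ (p - 1) else 0) * ‖f x‖ₑ := by
    intro m _
    by_cases h : w * 2 ^ m / 2 < ‖f x‖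
    · rw [indicator_of_mem (by exact h), if_pos (by linarith)]
    · rw [indicator_of_notMem (by exact h), mul_zero]; exact zero_le
  refine (Finset.sum_le_sum e2).trans ?_
  rw [← Finset.sum_mul, ← ENNReal.ofReal_sum_of_nonneg]
  · have hg := geom_filter (by linarith : 0 < p - 1) hw n (by positivity : 0 ≤ 2 * ‖f x‖)
    refine (mul_le_mul' (ENNReal.ofReal_le_ofReal hg) le_rfl).trans (le_of_eq ?_)
    rw [← ofReal_norm, ENNReal.ofReal_rpow_of_nonneg (norm_nonneg _) (by linarith),
      ← ENNReal.ofReal_mul (by positivity), ← ENNReal.ofReal_mul (by positivity),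
      Real.mul_rpow (by norm_num) (norm_nonneg _)]
    congr 1
    rcases (norm_nonneg (f x)).eq_or_lt with h0 | h0
    · rw [← h0, Real.zero_rpow (by linarith)]; simp
      rw [Real.zero_rpow (by linarith)]; simp
    · have : ‖f x‖ ^ p = ‖f x‖ ^ (p - 1) * ‖f x‖ := by
        rw [← Real.rpow_add_one h0.ne']; congr 1; ring
      rw [this]; ring
  · intro m _
    split_ifs
    · positivity
    · exact le_rfl

lemma good_congr {f : Ed d → ℂ} (hf : Integrable f) {ε l l' : ℝ} (hε : 0 < ε) (hl : 0 < l)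
    (hl' : 0 < l') (h : l = l') : good hf hε hl = good hf hε hl' := by
  subst h; rfl

lemma main_lt (hd : 1 ≤ d) (μ : Measure (Ed d)) [IsFiniteMeasure μ]
    (hcomp : ∃ K : Set (Ed d), IsCompact K ∧ μ Kᶜ = 0) {a C : ℝ} (ha : 0 < a)
    (hdecay : ∀ ξ : Ed d, ξ ≠ 0 → ‖mFT μ ξ‖ ≤ C * ‖ξ‖ ^ (-a))
    {β : ℝ → ℝ} (hβsm : ContDiff ℝ (⊤ : ℕ∞) β)
    (hβsupp : Function.support β ⊆ Ioo (1/2 : ℝ) 2) {p : ℝ} (hp1 : 1 < p) (hp2 : p < 2) :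
    ∃ M : ℝ, 0 ≤ M ∧ ∃ K : ℝ, 0 ≤ K ∧ ∀ (j : ℕ) (f : Ed d → ℂ), Integrable f → UniformContinuous f →
      (∃ B, ∀ x, ‖f x‖ ≤ B) → ∀ l : ℝ, 0 < l →
      ∫⁻ x, (TjStar μ β j f x - ENNReal.ofReal (K * l)) ^ p ≤
        ENNReal.ofReal (M * 2 ^ ((2 * a + 1 - 2 * a * p) * (j : ℝ))) * ∫⁻ x, ‖f x‖ₑ ^ p := by
  obtain ⟨M1, hM1, hlev⟩ := level_est hd μ hcomp ha hdecay hβsm hβsupp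
  obtain ⟨K1, hK1, hsup⟩ := TjStar_sup μ hβsm hβsupp
  obtain ⟨K2, hK2, hIntg⟩ := interp_enn hp1 hp2
  obtain ⟨K3, hK3, hW⟩ := sum_Wl (d := d) hp1
  refine ⟨K2 * (2 * M1) * K3, by positivity, K1 * 2 ^ d, by positivity, ?_⟩
  intro j f hf huc hbdd l hl
  obtain ⟨B, hB⟩ := hbdd
  have hfm : Measurable f := huc.continuous.measurable
  have hd0 : (0:ℝ) < d := by exact_mod_cast hd
  obtain ⟨δ, hδ, hδf⟩ := Metric.uniformContinuous_iff.1 huc l hl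
  set ε := δ / (2 * d) with hεdef
  have hε : 0 < ε := by positivity
  have hosc : ∀ x y : Ed d, ‖x - y‖ ≤ d * ε → ‖f x - f y‖ ≤ l := by
    intro x y hxy
    have : dist x y < δ := by
      rw [dist_eq_norm]
      refine hxy.trans_lt ?_
      rw [hεdef]; field_simp; linarith
    have := hδf this
    rw [dist_eq_norm] at this
    exact this.le
  obtain ⟨n, hn⟩ : ∃ n : ℕ, B ≤ l * 2 ^ n := by
    obtain ⟨n, hn⟩ := pow_unbounded_of_one_lt (B / l) (by norm_num : (1:ℝ) < 2)
    refine ⟨n, ?_⟩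
    rw [div_lt_iff₀ hl] at hn
    linarith
  have hlm : ∀ m : ℕ, 0 < l * 2 ^ m := fun m => by positivity
  set G : ℕ → Ed d → ℂ := fun m => good hf hε (hlm m) with hG
  have hDG : ∀ m, Dl hf hε (hlm m) = fun y => G (m + 1) y - G m y := by
    intro m
    unfold Dl
    rw [good_congr hf hε (mul_pos two_pos (hlm m)) (hlm (m + 1)) (by ring)]
  have hfG : G n = f := good_none hf hε (hlm n) fun x => (hB x).trans hn
  have hDi : ∀ m, Integrable (Dl hf hε (hlm m)) := fun m => by
    rw [hDG]
    exact (good_integrable hf hε (hlm _)).sub (good_integrable hf hε (hlm _))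
  have htel : f = fun y => G 0 y + ∑ m ∈ Finset.range n, Dl hf hε (hlm m) y := by
    funext y
    simp only [hDG]
    rw [Finset.sum_range_sub (fun m => G m y), hfG]; ring
  set u : ℕ → Ed d → ℝ≥0∞ := fun m => TjStar μ β j (Dl hf hε (hlm m)) with hu
  have hum : ∀ m, Measurable (u m) := fun m =>
    TjStar_measurable μ hβsm.continuous hβsupp j (hDi m)
  have hpt : ∀ x, TjStar μ β j f x - ENNReal.ofReal (K1 * 2 ^ d * l) ≤ ∑ m ∈ Finset.range n, u m x := by
    intro x
    rw [tsub_le_iff_left]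
    conv_lhs => rw [htel]
    refine (TjStar_add μ hβsm.continuous hβsupp j (good_integrable hf hε (hlm 0))
      (integrable_finsetSum _ fun m _ => hDi m) x).trans ?_
    refine add_le_add ?_ (TjStar_sum μ hβsm.continuous hβsupp j _ (fun m _ => hDi m) x)
    rw [mul_assoc]
    refine hsup j _ (2 ^ d * l) (by positivity) (good_integrable hf hε (hlm 0)) (fun z => ?_) x
    have := good_le hf hε (hlm 0) hd (by simpa using hosc) z
    simpa using this
  set b : ℝ := 2 ^ (-(2 * a) * (j : ℝ)) with hb
  have hb0 : 0 < b := by positivity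
  set E : ℝ := 2 ^ ((2 * a + 1 - 2 * a * p) * (j : ℝ)) with hE
  have hE0 : 0 < E := by positivity
  have two : (0:ℝ) < 2 := two_pos
  have hterm : ∀ m ∈ Finset.range n, ∫⁻ x, (ENNReal.ofReal ((b * l * 2 ^ m) ^ (p - 1)) * u m x +
        ENNReal.ofReal ((b * l * 2 ^ m) ^ (p - 2)) * u m x ^ 2) ≤
      ENNReal.ofReal (2 * M1 * E) * (ENNReal.ofReal ((l * 2 ^ m) ^ (p - 1)) * Wl f (l * 2 ^ m)) := by
    intro m _
    obtain ⟨h1, h2⟩ := hlev j f hf ε (l * 2 ^ m) hε (hlm m) (fun x y h => (hosc x y h).trans (by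
      have : (1:ℝ) ≤ 2 ^ m := one_le_pow₀ (by norm_num)
      nlinarith))
    have hq := hlm m
    rw [lintegral_add_left ((hum m).const_mul _), lintegral_const_mul _ (hum m),
      lintegral_const_mul _ ((hum m).pow_const 2)]
    refine (add_le_add (mul_le_mul' le_rfl h1) (mul_le_mul' le_rfl h2)).trans (le_of_eq ?_)
    rw [← mul_assoc, ← mul_assoc, ← mul_assoc (ENNReal.ofReal (2 * M1 * E)), ← add_mul, ← ENNReal.ofReal_mul (by positivity),
      ← ENNReal.ofReal_mul (by positivity), ← ENNReal.ofReal_mul (by positivity),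
      ← ENNReal.ofReal_add (by positivity) (by positivity)]
    congr 2
    set q := l * 2 ^ m with hqd
    have r1 : (b * l * 2 ^ m) ^ (p - 1) * 2 ^ (j : ℝ) = E * q ^ (p - 1) := by
      rw [mul_assoc b, ← hqd, Real.mul_rpow hb0.le hq.le, hb, ← Real.rpow_mul two.le, hE]
      have : (2:ℝ) ^ ((2 * a + 1 - 2 * a * p) * (j:ℝ)) =
          2 ^ (-(2 * a) * (j:ℝ) * (p - 1)) * 2 ^ (j:ℝ) := by
        rw [← Real.rpow_add two]; congr 1; ring
      rw [this]; ring
    have r2 : (b * l * 2 ^ m) ^ (p - 2) * (2 ^ ((1 - 2 * a) * (j : ℝ)) * q) = E * q ^ (p - 1) := by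
      rw [mul_assoc b, ← hqd, Real.mul_rpow hb0.le hq.le, hb, ← Real.rpow_mul two.le, hE]
      have : (2:ℝ) ^ ((2 * a + 1 - 2 * a * p) * (j:ℝ)) =
          2 ^ (-(2 * a) * (j:ℝ) * (p - 2)) * 2 ^ ((1 - 2 * a) * (j : ℝ)) := by
        rw [← Real.rpow_add two]; congr 1; ring
      have h3 : q ^ (p - 1) = q ^ (p - 2) * q := by
        rw [← Real.rpow_add_one hq.ne']; congr 1; ring
      rw [this, h3]; ring
    calc _ = M1 * ((b * l * 2 ^ m) ^ (p - 1) * 2 ^ (j : ℝ)) +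
          M1 * ((b * l * 2 ^ m) ^ (p - 2) * (2 ^ ((1 - 2 * a) * (j : ℝ)) * q)) := by ring
      _ = _ := by rw [r1, r2]; ring
  calc ∫⁻ x, (TjStar μ β j f x - ENNReal.ofReal (K1 * 2 ^ d * l)) ^ p
      ≤ ∫⁻ x, ENNReal.ofReal K2 * ∑ m ∈ Finset.range n,
        (ENNReal.ofReal ((b * l * 2 ^ m) ^ (p - 1)) * u m x +
        ENNReal.ofReal ((b * l * 2 ^ m) ^ (p - 2)) * u m x ^ 2) := by
        refine lintegral_mono fun x => ?_
        refine (ENNReal.rpow_le_rpow (hpt x) (by linarith)).trans ?_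
        exact hIntg (b * l) (by positivity) n (fun m => u m x)
    _ = ENNReal.ofReal K2 * ∑ m ∈ Finset.range n, ∫⁻ x,
        (ENNReal.ofReal ((b * l * 2 ^ m) ^ (p - 1)) * u m x +
        ENNReal.ofReal ((b * l * 2 ^ m) ^ (p - 2)) * u m x ^ 2) := by
        rw [lintegral_const_mul' _ _ ENNReal.ofReal_ne_top, lintegral_finsetSum]
        intro m _
        exact ((hum m).const_mul _).add (((hum m).pow_const 2).const_mul _)
    _ ≤ ENNReal.ofReal K2 * (ENNReal.ofReal (2 * M1 * E) * (ENNReal.ofReal K3 * ∫⁻ x, ‖f x‖ₑ ^ p)) := by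
        refine mul_le_mul' le_rfl ((Finset.sum_le_sum hterm).trans ?_)
        rw [← Finset.mul_sum]
        exact mul_le_mul' le_rfl (hW l hl n f hfm)
    _ = _ := by
        rw [← mul_assoc, ← mul_assoc, ← ENNReal.ofReal_mul hK2.le, ← ENNReal.ofReal_mul (by positivity)]
        congr 2
        ring

lemma main_lt' (hd : 1 ≤ d) (μ : Measure (Ed d)) [IsFiniteMeasure μ]
    (hcomp : ∃ K : Set (Ed d), IsCompact K ∧ μ Kᶜ = 0) {a C : ℝ} (ha : 0 < a)
    (hdecay : ∀ ξ : Ed d, ξ ≠ 0 → ‖mFT μ ξ‖ ≤ C * ‖ξ‖ ^ (-a))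
    {β : ℝ → ℝ} (hβsm : ContDiff ℝ (⊤ : ℕ∞) β)
    (hβsupp : Function.support β ⊆ Ioo (1/2 : ℝ) 2) {p : ℝ} (hp1 : 1 < p) (hp2 : p < 2) :
    ∃ M : ℝ, 0 ≤ M ∧ ∀ (j : ℕ) (f : Ed d → ℂ), Integrable f → UniformContinuous f →
      (∃ B, ∀ x, ‖f x‖ ≤ B) →
      ∫⁻ x, (TjStar μ β j f x) ^ p ≤
        ENNReal.ofReal (M * 2 ^ ((2 * a + 1 - 2 * a * p) * (j : ℝ))) * ∫⁻ x, ‖f x‖ₑ ^ p := by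
  obtain ⟨M, hM, K, hK, h⟩ := main_lt hd μ hcomp ha hdecay hβsm hβsupp hp1 hp2
  refine ⟨M, hM, ?_⟩
  intro j f hf huc hb
  have hlim : ∀ x, Filter.Tendsto (fun n : ℕ =>
      (TjStar μ β j f x - ENNReal.ofReal (K * (1 / ((n:ℝ) + 1)))) ^ p) Filter.atTop
      (nhds ((TjStar μ β j f x) ^ p)) := by
    intro x
    have h0 : Filter.Tendsto (fun n : ℕ => ENNReal.ofReal (K * (1 / ((n:ℝ) + 1)))) Filter.atTop (nhds 0) := by
      have := (tendsto_one_div_add_atTop_nhds_zero_nat (𝕜 := ℝ)).const_mul K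
      rw [mul_zero] at this
      have h3 := (ENNReal.continuous_ofReal.tendsto 0).comp this
      rw [ENNReal.ofReal_zero] at h3
      exact h3
    have h1 := ENNReal.Tendsto.sub (tendsto_const_nhds (x := TjStar μ β j f x)) h0
      (Or.inr ENNReal.zero_ne_top)
    rw [tsub_zero] at h1
    exact ((ENNReal.continuous_rpow_const (y := p)).tendsto _).comp h1
  have hTm := TjStar_measurable μ hβsm.continuous hβsupp j hf
  calc ∫⁻ x, (TjStar μ β j f x) ^ p
      = ∫⁻ x, Filter.liminf (fun n : ℕ =>
        (TjStar μ β j f x - ENNReal.ofReal (K * (1 / ((n:ℝ) + 1)))) ^ p) Filter.atTop := by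
        refine lintegral_congr fun x => ((hlim x).liminf_eq).symm
    _ ≤ Filter.liminf (fun n : ℕ => ∫⁻ x,
        (TjStar μ β j f x - ENNReal.ofReal (K * (1 / ((n:ℝ) + 1)))) ^ p) Filter.atTop :=
        lintegral_liminf_le fun n => (hTm.sub measurable_const).pow_const p
    _ ≤ _ := by
        refine Filter.liminf_le_of_le (by isBoundedDefault) ?_
        intro b hb'
        obtain ⟨n, hn⟩ := hb'.exists
        exact hn.trans (h j f hf huc hb _ (by positivity))


lemma main_le (hd : 1 ≤ d) (μ : Measure (Ed d)) [IsFiniteMeasure μ]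
    (hcomp : ∃ K : Set (Ed d), IsCompact K ∧ μ Kᶜ = 0) {a C : ℝ} (ha : 0 < a)
    (hdecay : ∀ ξ : Ed d, ξ ≠ 0 → ‖mFT μ ξ‖ ≤ C * ‖ξ‖ ^ (-a))
    {β : ℝ → ℝ} (hβsm : ContDiff ℝ (⊤ : ℕ∞) β)
    (hβsupp : Function.support β ⊆ Ioo (1/2 : ℝ) 2) {p : ℝ} (hp1 : 1 < p) (hp2 : p ≤ 2) :
    ∃ M : ℝ, 0 ≤ M ∧ ∀ (j : ℕ) (f : Ed d → ℂ), Integrable f → UniformContinuous f →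
      (∃ B, ∀ x, ‖f x‖ ≤ B) →
      ∫⁻ x, (TjStar μ β j f x) ^ p ≤
        ENNReal.ofReal (M * 2 ^ ((2 * a + 1 - 2 * a * p) * (j : ℝ))) * ∫⁻ x, ‖f x‖ₑ ^ p := by
  rcases hp2.eq_or_lt with h2 | h2
  · have hcomp2 : ∃ R : ℝ, 0 < R ∧ ∀ᵐ y ∂μ, ‖y‖ ≤ R := by
      obtain ⟨S, hS, hSμ⟩ := hcomp
      obtain ⟨R0, hR0⟩ := hS.isBounded.exists_norm_le
      refine ⟨max R0 1, by positivity, ?_⟩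
      have : ∀ᵐ y ∂μ, y ∈ S := by
        rw [ae_iff]; exact hSμ
      filter_upwards [this] with y hy
      exact (hR0 y hy).trans (le_max_left _ _)
    obtain ⟨M, hM, h⟩ := L2_star hd μ hcomp2 ha hdecay hβsm hβsupp
    refine ⟨M, hM, ?_⟩
    intro j f hf _ hb
    obtain ⟨B, hB⟩ := hb
    have := h j f hf (memLp_two_of_bdd hf hB)
    subst h2
    simp only [ENNReal.rpow_two]
    rw [show 2 * a + 1 - 2 * a * 2 = 1 - 2 * a by ring]
    exact this
  · exact main_lt' hd μ hcomp ha hdecay hβsm hβsupp hp1 h2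

/-- L^p bound for the frequency-localized maximal multiplier operator, 1 < p ≤ 2:
‖T_j^* f‖_{L^p} ≤ C' 2^{(2a+1)(1/p − 2a/(2a+1)) j} ‖f‖_{L^p}. -/
theorem stmt7 (d : ℕ) (hd : 1 ≤ d) (μ : Measure (EuclideanSpace ℝ (Fin d)))
    [IsFiniteMeasure μ] (hcomp : ∃ K : Set (EuclideanSpace ℝ (Fin d)), IsCompact K ∧ μ Kᶜ = 0)
    (a C : ℝ) (ha : 1/2 < a)
    (hdecay : ∀ ξ : EuclideanSpace ℝ (Fin d), ξ ≠ 0 → ‖mFT μ ξ‖ ≤ C * ‖ξ‖ ^ (-a))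
    (β : ℝ → ℝ) (hβsm : ContDiff ℝ (⊤ : ℕ∞) β)
    (hβsupp : Function.support β ⊆ Ioo (1/2 : ℝ) 2)
    (hβsum : ∀ t : ℝ, 0 < t → HasSum (fun j : ℤ => β ((2:ℝ) ^ j * t)) 1)
    (p : ℝ) (hp1 : 1 < p) (hp2 : p ≤ 2) :
    ∃ C' : ℝ, 0 < C' ∧ ∀ j : ℕ, 1 ≤ j → ∀ f : SchwartzMap (EuclideanSpace ℝ (Fin d)) ℂ,
      lpE (TjStar μ β j ⇑f) p ≤
        ENNReal.ofReal (C' * 2 ^ ((2*a+1) * (1/p - 2*a/(2*a+1)) * (j:ℝ))) *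
          (∫⁻ x, (‖f x‖₊ : ℝ≥0∞) ^ p) ^ (1/p) := by
  obtain ⟨M, hM, h⟩ := main_le hd μ hcomp (by linarith : 0 < a) hdecay hβsm hβsupp hp1 hp2
  have hp0 : 0 < p := by linarith
  refine ⟨(M + 1) ^ (1 / p), by positivity, ?_⟩
  intro j _ f
  have hb : ∃ B, ∀ x, ‖f x‖ ≤ B := by
    obtain ⟨B, _, hB⟩ := schwartz_decay0 f 0
    exact ⟨B, fun w => by simpa using hB w⟩
  have huc : UniformContinuous f :=
    Continuous.uniformContinuous_of_tendsto_cocompact f.continuous (zero_at_infty f)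
  have h1 := h j f f.integrable huc hb
  have h2 : ENNReal.ofReal (M * 2 ^ ((2 * a + 1 - 2 * a * p) * (j : ℝ))) ≤
      ENNReal.ofReal ((M + 1) * 2 ^ ((2 * a + 1 - 2 * a * p) * (j : ℝ))) := by
    apply ENNReal.ofReal_le_ofReal
    gcongr
    linarith
  have h3 := ENNReal.rpow_le_rpow (h1.trans (mul_le_mul' h2 le_rfl)) (by positivity : 0 ≤ 1 / p)
  rw [ENNReal.mul_rpow_of_nonneg _ _ (by positivity),
    ENNReal.ofReal_rpow_of_nonneg (by positivity) (by positivity),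
    Real.mul_rpow (by positivity) (by positivity), ← Real.rpow_mul (by norm_num)] at h3
  have e : (2 * a + 1 - 2 * a * p) * (j : ℝ) * (1 / p) =
      (2*a+1) * (1/p - 2*a/(2*a+1)) * (j:ℝ) := by
    have : 2 * a + 1 ≠ 0 := by linarith
    field_simp
  rw [e] at h3
  exact h3
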